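/- arXiv:1002.3769 — 5 statements merged into one kernel-verified Lean document; each statement's English description precedes it below -/
import Mathlib

section
/- Let T be a tile system in an arbitrary neighborhood N, with finite set of glues X. There exist a finite glue set X_μ, a tile system T_μ in neighborhood N_vN over X_μ, a scale s ≥ 1, a polyomino assignment φ of scale s from T to finite (T_μ,N_vN)-tilings, and a tiling-simulation ψ of T by T_μ; in particular every (T,N)-tiling is simulated by some (T_μ,N_vN)-tiling. -/
namespace Paper

open scoped Classical

abbrev Pos : Type := ℤ × ℤ

/-- The von Neumann neighborhood. -/
def Nvn : Set Pos := {(0, 1), (1, 0), (0, -1), (-1, 0)}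

/-- A neighborhood: a finite symmetric set of positions not containing the origin. -/
def IsNeighborhood (N : Set Pos) : Prop :=
  N.Finite ∧ (0, 0) ∉ N ∧ ∀ w ∈ N, -w ∈ N

/-- A tile over glues `X` and neighborhood `N` : a function from `N` to `X`. -/
abbrev Tile (X : Type) (N : Set Pos) : Type := {w : Pos // w ∈ N} → X

/-- Scaling a position by an integer. -/
def sc (s : ℤ) (u : Pos) : Pos := (s * u.1, s * u.2)

/-- Domain of a partial map on the plane. -/
def tdom {α : Type} (τ : Pos → Option α) : Set Pos := {p | τ p ≠ none}

/-- A (T,N)-tiling: a partial map to tiles of `T` such that all neighboring glues match. -/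
def IsTiling {X : Type} {N : Set Pos} (T : Set (Tile X N))
    (τ : Pos → Option (Tile X N)) : Prop :=
  (∀ p t, τ p = some t → t ∈ T) ∧
  (∀ p t, τ p = some t → ∀ w t', τ (p + w) = some t' →
    ∀ (hw : w ∈ N) (hw' : -w ∈ N), t ⟨w, hw⟩ = t' ⟨-w, hw'⟩)

def IsFiniteTiling {X : Type} {N : Set Pos} (T : Set (Tile X N))
    (τ : Pos → Option (Tile X N)) : Prop :=
  IsTiling T τ ∧ (tdom τ).Finite

/-- A partial map on the plane is total if it is defined everywhere. -/
def TotalDom {α : Type} (τ : Pos → Option α) : Prop := ∀ p, τ p ≠ none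

/-- A poly-tiling of scale `s`: a partial map from grid positions to finite tilings,
satisfying (i) each component is a finite tiling, (ii) translated domains are disjoint,
(iii) neighboring (after translation) tiles of two components have matching glues. -/
def IsPolyTiling {X : Type} {N : Set Pos} (T : Set (Tile X N)) (s : ℤ)
    (σ : Pos → Option (Pos → Option (Tile X N))) : Prop :=
  (∀ u τu, σ u = some τu → IsFiniteTiling T τu) ∧
  (∀ u v τu τv, u ≠ v → σ u = some τu → σ v = some τv →
    ∀ p, τu p ≠ none → ∀ q, τv q ≠ none → sc s u + p ≠ sc s v + q) ∧
  (∀ u u' τu τu', σ u = some τu → σ u' = some τu' →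
    ∀ v t, τu v = some t → ∀ v' t', τu' v' = some t' →
    ∀ (hw : (sc s u' + v') - (sc s u + v) ∈ N)
      (hw' : -((sc s u' + v') - (sc s u + v)) ∈ N),
      t ⟨(sc s u' + v') - (sc s u + v), hw⟩ =
        t' ⟨-((sc s u' + v') - (sc s u + v)), hw'⟩)

/-- The tiling induced by a poly-tiling: position `s•u + v` carries the tile `σ u v`. -/
noncomputable def induced {α : Type} (s : ℤ) (σ : Pos → Option (Pos → Option α)) :
    Pos → Option α := fun p =>
  if h : ∃ t, ∃ u τu v, σ u = some τu ∧ τu v = some t ∧ p = sc s u + v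
    then some h.choose else none

/-- Periodicity of a (partial) tiling, with horizontal and vertical periods. -/
def PeriodicT {α : Type} (τ : Pos → Option α) : Prop :=
  ∃ ph pv : ℤ, 0 < ph ∧ 0 < pv ∧
    ∀ (p : Pos) (a b : ℤ), τ p ≠ none →
      τ (p.1 + a * ph, p.2 + b * pv) ≠ none →
      τ p = τ (p.1 + a * ph, p.2 + b * pv)

def LineConvex {α : Type} (τ : Pos → Option α) : Prop :=
  ∀ x₁ x₂ x y : ℤ, τ (x₁, y) ≠ none → τ (x₂, y) ≠ none →
    x₁ < x → x < x₂ → τ (x, y) ≠ none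

def ColumnConvex {α : Type} (τ : Pos → Option α) : Prop :=
  ∀ x y₁ y₂ y : ℤ, τ (x, y₁) ≠ none → τ (x, y₂) ≠ none →
    y₁ < y → y < y₂ → τ (x, y) ≠ none

/-- 4-connectedness of a set of positions. -/
def ConnectedDom (D : Set Pos) : Prop :=
  ∀ p ∈ D, ∀ q ∈ D, ∃ (n : ℕ) (c : ℕ → Pos), c 0 = p ∧ c n = q ∧
    (∀ k ≤ n, c k ∈ D) ∧ ∀ k < n, c (k + 1) - c k ∈ Nvn

/-- The connected linear neighborhood `N_n`. -/
def Nlin (n : ℤ) : Set Pos := {w | w.2 = 0 ∧ 0 < |w.1| ∧ |w.1| ≤ n}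

/-- The rectangular neighborhood `N_{m,n}`. -/
def Nrect (m n : ℤ) : Set Pos := {w | |w.1| ≤ m ∧ |w.2| ≤ n ∧ w ≠ (0, 0)}

/-- A set of consecutive integers. -/
def IsInterval (I : Set ℤ) : Prop :=
  ∀ a b c : ℤ, a ∈ I → c ∈ I → a ≤ b → b ≤ c → b ∈ I

/-- A path: a map from a set of consecutive integers to the plane, consecutive
positions being (von Neumann) adjacent. -/
def IsPath (I : Set ℤ) (P : ℤ → Pos) : Prop :=
  IsInterval I ∧ ∀ i : ℤ, i ∈ I → i + 1 ∈ I → P (i + 1) - P i ∈ Nvn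

/-- A T-tiled path: a path together with a map from its range to tiles of `T`. -/
def IsTiledPath {X : Type} {N : Set Pos} (T : Set (Tile X N)) (I : Set ℤ)
    (P : ℤ → Pos) (r : Pos → Option (Tile X N)) : Prop :=
  IsPath I P ∧ tdom r = P '' I ∧ ∀ p t, r p = some t → t ∈ T

/-- A T-ribbon: an injective tiled path in which consecutive tiles stick. -/
def IsRibbon {X : Type} (T : Set (Tile X Nvn)) (I : Set ℤ) (P : ℤ → Pos)
    (r : Pos → Option (Tile X Nvn)) : Prop :=
  IsTiledPath T I P r ∧ (∀ i ∈ I, ∀ j ∈ I, P i = P j → i = j) ∧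
  (∀ i : ℤ, i ∈ I → i + 1 ∈ I → ∀ t t', r (P i) = some t → r (P (i + 1)) = some t' →
    ∀ (hv : P (i + 1) - P i ∈ Nvn) (hv' : -(P (i + 1) - P i) ∈ Nvn),
      t ⟨P (i + 1) - P i, hv⟩ = t' ⟨-(P (i + 1) - P i), hv'⟩)

/-- A (T,N)-zipper: an injective tiled path whose tile map is a (T,N)-tiling. -/
def IsZipper {X : Type} {N : Set Pos} (T : Set (Tile X N)) (I : Set ℤ)
    (P : ℤ → Pos) (r : Pos → Option (Tile X N)) : Prop :=
  IsTiledPath T I P r ∧ (∀ i ∈ I, ∀ j ∈ I, P i = P j → i = j) ∧ IsTiling T r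

/-- Bundled T-ribbons (tile system in the von Neumann neighborhood). -/
structure Ribbon (X : Type) (T : Set (Tile X Nvn)) : Type where
  I : Set ℤ
  P : ℤ → Pos
  r : Pos → Option (Tile X Nvn)
  isRibbon : IsRibbon T I P r

/-- A poly-ribbon of scale `s` with macro path `(J, Q)` and components `ρ`. -/
def IsPolyRibbon {X : Type} {T : Set (Tile X Nvn)} (s : ℤ) (J : Set ℤ)
    (Q : ℤ → Pos) (ρ : Pos → Option (Ribbon X T)) : Prop :=
  IsPath J Q ∧ (∀ i ∈ J, ∀ j ∈ J, Q i = Q j → i = j) ∧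
  tdom ρ = Q '' J ∧
  (∀ u R, ρ u = some R → R.I.Finite ∧ R.I.Nonempty) ∧
  (∀ u v R S, u ≠ v → ρ u = some R → ρ v = some S →
    ∀ p, R.r p ≠ none → ∀ q, S.r q ≠ none → sc s u + p ≠ sc s v + q) ∧
  (∀ j : ℤ, j ∈ J → j + 1 ∈ J → ∀ R₁ R₂, ρ (Q j) = some R₁ → ρ (Q (j + 1)) = some R₂ →
    ∀ m₁, IsGreatest R₁.I m₁ → ∀ m₂, IsLeast R₂.I m₂ →
      ((sc s (Q (j + 1)) + R₂.P m₂) - (sc s (Q j) + R₁.P m₁) ∈ Nvn ∧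
      ∀ t₁ t₂, R₁.r (R₁.P m₁) = some t₁ → R₂.r (R₂.P m₂) = some t₂ →
        ∀ (hv : (sc s (Q (j + 1)) + R₂.P m₂) - (sc s (Q j) + R₁.P m₁) ∈ Nvn)
          (hv' : -((sc s (Q (j + 1)) + R₂.P m₂) - (sc s (Q j) + R₁.P m₁)) ∈ Nvn),
          t₁ ⟨(sc s (Q (j + 1)) + R₂.P m₂) - (sc s (Q j) + R₁.P m₁), hv⟩ =
            t₂ ⟨-((sc s (Q (j + 1)) + R₂.P m₂) - (sc s (Q j) + R₁.P m₁)), hv'⟩))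

/-- A zipper-simulation of `T` (in neighborhood `N`) by `Tμ` (in the von Neumann
neighborhood), of scale `s`, consisting of a polyomino assignment `phi`, the
trimming map `chi` and the simulation map `psi`. -/
structure ZipperSimulation (X Xμ : Type) (N : Set Pos) (T : Set (Tile X N))
    (Tμ : Set (Tile Xμ Nvn)) (s : ℤ) : Type where
  hs : 1 ≤ s
  phi : Tile X N → Set (Ribbon Xμ Tμ)
  phi_fin : ∀ t, ∀ R ∈ phi t, R.I.Finite ∧ R.I.Nonempty
  phi_ref : ∀ t, ∀ R ∈ phi t, R.r (0, 0) ≠ none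
  phi_spec : ∀ t t', t ≠ t' → ∀ R ∈ phi t, ∀ S ∈ phi t',
    ∀ p q a b, R.r p = some a → S.r q = some b → a ≠ b
  chi : Ribbon Xμ Tμ → Pos → Option (Ribbon Xμ Tμ)
  chi_poly : ∀ R : Ribbon Xμ Tμ, ∃ J Q, IsPolyRibbon s J Q (chi R)
  chi_sub : ∀ R u S, chi R u = some S →
    (∃ t ∈ T, S ∈ phi t) ∧ ∀ p a, S.r p = some a → R.r (sc s u + p) = some a
  chi_max : ∀ (R : Ribbon Xμ Tμ) (t : Tile X N), t ∈ T → ∀ S ∈ phi t, ∀ u : Pos,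
    (∀ p a, S.r p = some a → R.r (sc s u + p) = some a) → chi R u ≠ none
  psi : Set ℤ → (ℤ → Pos) → (Pos → Option (Tile X N)) → Set (Pos → Option (Ribbon Xμ Tμ))
  psi_nonempty : ∀ I P r, IsZipper T I P r → (psi I P r).Nonempty
  psi_poly : ∀ I P r, IsZipper T I P r → ∀ ρ ∈ psi I P r, IsPolyRibbon s I P ρ
  psi_comp : ∀ I P r, IsZipper T I P r → ∀ ρ ∈ psi I P r,
    ∀ u t, r u = some t → ∀ S, ρ u = some S → S ∈ phi t
  psi_exists : ∀ R : Ribbon Xμ Tμ, ∃ I P r, IsZipper T I P r ∧ chi R ∈ psi I P r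
  psi_unique : ∀ (R : Ribbon Xμ Tμ) I P r I' P' r',
    IsZipper T I P r → IsZipper T I' P' r' →
    chi R ∈ psi I P r → chi R ∈ psi I' P' r' →
    r = r' ∧ ∃ d : ℤ, (∀ i, i ∈ I ↔ i + d ∈ I') ∧ ∀ i ∈ I, P' (i + d) = P i

/-- A tiling-simulation of `T` (in neighborhood `N`) by `Tμ` (in the von Neumann
neighborhood), of scale `s`, consisting of a polyomino assignment `phi`, the
trimming map `chi` and the simulation map `psi`. -/
structure TilingSimulation (X Xμ : Type) (N : Set Pos) (T : Set (Tile X N))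
    (Tμ : Set (Tile Xμ Nvn)) (s : ℤ) : Type where
  hs : 1 ≤ s
  phi : Tile X N → Set (Pos → Option (Tile Xμ Nvn))
  phi_fin : ∀ t, ∀ τ' ∈ phi t, IsFiniteTiling Tμ τ'
  phi_ref : ∀ t, ∀ τ' ∈ phi t, τ' (0, 0) ≠ none
  phi_spec : ∀ t t', t ≠ t' → ∀ τ₁ ∈ phi t, ∀ τ₂ ∈ phi t',
    ∀ p q a b, τ₁ p = some a → τ₂ q = some b → a ≠ b
  chi : (Pos → Option (Tile Xμ Nvn)) → Pos → Option (Pos → Option (Tile Xμ Nvn))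
  chi_poly : ∀ τ', IsTiling Tμ τ' → IsPolyTiling Tμ s (chi τ')
  chi_sub : ∀ τ' u σu, chi τ' u = some σu →
    (∃ t ∈ T, σu ∈ phi t) ∧ ∀ p a, σu p = some a → τ' (sc s u + p) = some a
  chi_max : ∀ (τ' : Pos → Option (Tile Xμ Nvn)) (t : Tile X N), t ∈ T →
    ∀ σu ∈ phi t, ∀ u : Pos,
    (∀ p a, σu p = some a → τ' (sc s u + p) = some a) → chi τ' u ≠ none
  psi : (Pos → Option (Tile X N)) → Set (Pos → Option (Pos → Option (Tile Xμ Nvn)))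
  psi_nonempty : ∀ τ, IsTiling T τ → (psi τ).Nonempty
  psi_poly : ∀ τ, IsTiling T τ → ∀ σ ∈ psi τ, IsPolyTiling Tμ s σ
  psi_dom : ∀ τ, IsTiling T τ → ∀ σ ∈ psi τ, ∀ u, σ u ≠ none ↔ τ u ≠ none
  psi_comp : ∀ τ, IsTiling T τ → ∀ σ ∈ psi τ,
    ∀ u t, τ u = some t → ∀ σu, σ u = some σu → σu ∈ phi t
  psi_recover : ∀ τ', IsTiling Tμ τ' → ∃! τ, IsTiling T τ ∧ chi τ' ∈ psi τ

/-- Lexicographic positivity, selecting one element of each pair `{w, -w}` with `w ≠ 0`. -/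
def IsPos (w : Pos) : Prop := 0 < w.1 ∨ (w.1 = 0 ∧ 0 < w.2)

lemma isPos_neg_iff {w : Pos} (hw : w ≠ (0, 0)) : IsPos (-w) ↔ ¬ IsPos w := by
  obtain ⟨a, b⟩ := w
  simp only [ne_eq, Prod.mk.injEq] at hw
  simp only [IsPos, Prod.neg_mk]
  omega

/-- Glues of the simulating system: vertical sides carry the identity of a micro tile,
horizontal sides carry either a glue of `X` or a blank glue. -/
abbrev MicroGlue (X : Type) (N : Set Pos) : Type :=
  (Tile X N × Option {w : Pos // w ∈ N}) ⊕ Option X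

/-- The glue shown on the east side: that of a positive direction, or blank. -/
noncomputable def eastGlue {X : Type} {N : Set Pos} (t : Tile X N) :
    Option {w : Pos // w ∈ N} → Option X
  | none => none
  | some w => if IsPos w.1 then some (t w) else none

/-- The glue shown on the west side: that of a non-positive direction, or blank. -/
noncomputable def westGlue {X : Type} {N : Set Pos} (t : Tile X N) :
    Option {w : Pos // w ∈ N} → Option X
  | none => none
  | some w => if IsPos w.1 then none else some (t w)

/-- The micro tiles of `t`: a reference tile (index `none`), and for each `w ∈ N` a tile
(index `some w`) exposing the glue `t w`. -/
noncomputable def microTile {X : Type} {N : Set Pos} (t : Tile X N)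
    (k : Option {w : Pos // w ∈ N}) : Tile (MicroGlue X N) Nvn := fun d =>
  if d.1 = (1, 0) then Sum.inr (eastGlue t k)
  else if d.1 = (-1, 0) then Sum.inr (westGlue t k)
  else Sum.inl (t, k)

lemma microTile_inj {X : Type} {N : Set Pos} {t t' : Tile X N}
    {k l : Option {w : Pos // w ∈ N}} (h : microTile t k = microTile t' l) :
    t = t' ∧ k = l := by
  simpa [microTile] using congrFun h ⟨(0, 1), by simp [Nvn]⟩

/-- The column, modulo the scale, of the micro tile with a given index. -/
noncomputable def col {N : Set Pos} : Option {w : Pos // w ∈ N} → ℤ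
  | none => 0
  | some w => if IsPos w.1 then 2 * (Encodable.encode w.1 : ℤ) + 2
      else 2 * (Encodable.encode (-w.1) : ℤ) + 3

/-- The macro position in which the micro tile with a given index is placed. -/
noncomputable def shift {N : Set Pos} : Option {w : Pos // w ∈ N} → Pos
  | none => (0, 0)
  | some w => if IsPos w.1 then (0, 0) else w.1

/-- The position of a micro tile relative to the reference tile. -/
noncomputable def offset {N : Set Pos} (s : ℤ) (k : Option {w : Pos // w ∈ N}) : Pos :=
  sc s (shift k) + (col k, 0)

lemma offset_none {N : Set Pos} (s : ℤ) :
    offset s (none : Option {w : Pos // w ∈ N}) = (0, 0) := by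
  simp [offset, shift, col, sc]

/-- The scale is large enough for the micro tiles to have distinct columns. -/
def IsScale (N : Set Pos) (s : ℤ) : Prop :=
  2 ≤ s ∧ ∀ w ∈ N, 2 * (Encodable.encode w : ℤ) + 4 < s

lemma exists_isScale {N : Set Pos} (hN : N.Finite) : ∃ s, IsScale N s := by
  obtain ⟨b, hb⟩ := (hN.image fun w => 2 * (Encodable.encode w : ℤ) + 4).bddAbove
  refine ⟨max 2 (b + 1), le_max_left _ _, fun w hw => ?_⟩
  exact lt_max_of_lt_right (Int.lt_add_one_of_le (hb ⟨w, hw, rfl⟩))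

lemma mul_add_inj {s x y a b : ℤ} (ha : 0 ≤ a) (has : a < s) (hb : 0 ≤ b) (hbs : b < s)
    (h : s * x + a = s * y + b) : a = b ∧ x = y := by
  have h' := congrArg (· % s) h
  simp only [Int.mul_add_emod_self_left, Int.emod_eq_of_lt ha has,
    Int.emod_eq_of_lt hb hbs] at h'
  refine ⟨h', mul_left_cancel₀ (by omega : s ≠ 0) ?_⟩
  omega

section Placement

variable {X : Type} {N : Set Pos} {s : ℤ}

lemma col_nonneg (k : Option {w : Pos // w ∈ N}) : 0 ≤ col k := by
  rcases k with _ | w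
  · simp [col]
  · simp only [col]; split_ifs <;> omega

lemma col_add_one_lt (hN : IsNeighborhood N) (hs : IsScale N s)
    (k : Option {w : Pos // w ∈ N}) : col k + 1 < s := by
  rcases k with _ | w
  · have := hs.1
    simp only [col]; omega
  · have h₁ := hs.2 _ w.2
    have h₂ := hs.2 _ (hN.2.2 _ w.2)
    simp only [col]; split_ifs <;> omega

lemma col_injective : Function.Injective (col (N := N)) := by
  rintro (_ | w) (_ | w') h
  · rfl
  · simp only [col] at h; split_ifs at h <;> omega
  · simp only [col] at h; split_ifs at h <;> omega
  · simp only [col] at h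
    congr 1
    apply Subtype.ext
    split_ifs at h
    · exact Encodable.encode_injective (by omega)
    · omega
    · omega
    · exact neg_injective (Encodable.encode_injective (by omega))

/-- Micro tiles with consecutive columns are the two ends of a common direction, or
face each other with blank glues. -/
lemma col_succ {k l : Option {w : Pos // w ∈ N}}
    (h : col l = col k + 1) (t t' : Tile X N) :
    (eastGlue t k = none ∧ westGlue t' l = none) ∨
      ∃ (w : Pos) (hw : w ∈ N) (hw' : -w ∈ N), IsPos w ∧ ¬ IsPos (-w) ∧
        k = some ⟨w, hw⟩ ∧ l = some ⟨-w, hw'⟩ := by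
  rcases k with _ | ⟨w, hw⟩
  · rcases l with _ | ⟨w', hw'⟩
    · simp [eastGlue, westGlue]
    · simp only [col] at h
      split_ifs at h with hp
      · omega
      · omega
  · by_cases hp : IsPos w
    · rcases l with _ | ⟨w', hw'⟩
      · simp only [col, hp, if_true] at h; omega
      · by_cases hp' : IsPos w'
        · simp only [col, hp, hp', if_true] at h; omega
        · simp only [col, hp, hp', if_true, if_false] at h
          have e : -w' = w := Encodable.encode_injective (by omega)
          have e' : w' = -w := by rw [← e, neg_neg]
          subst e'
          exact Or.inr ⟨w, hw, hw', hp, hp', rfl, rfl⟩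
    · refine Or.inl ⟨by simp [eastGlue, hp], ?_⟩
      rcases l with _ | ⟨w', hw'⟩
      · rfl
      · by_cases hp' : IsPos w'
        · simp [westGlue, hp']
        · simp only [col, hp, hp', if_false] at h; omega

lemma placement_eq (u : Pos) (k : Option {w : Pos // w ∈ N}) :
    sc s u + offset s k = (s * (u + shift k).1 + col k, s * (u + shift k).2) := by
  ext <;> simp [sc, offset] <;> ring

lemma placement_inj (hN : IsNeighborhood N) (hs : IsScale N s) {u v : Pos}
    {k l : Option {w : Pos // w ∈ N}} (h : sc s u + offset s k = sc s v + offset s l) :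
    u = v ∧ k = l := by
  rw [placement_eq, placement_eq, Prod.mk.injEq] at h
  have hk := col_add_one_lt hN hs k
  have hl := col_add_one_lt hN hs l
  obtain ⟨hc, h₁⟩ := mul_add_inj (col_nonneg k) (by omega) (col_nonneg l) (by omega) h.1
  have h₂ := mul_left_cancel₀ (by have := hs.1; omega : s ≠ 0) h.2
  obtain rfl := col_injective hc
  exact ⟨add_right_cancel (Prod.ext h₁ h₂), rfl⟩

lemma placement_east (hN : IsNeighborhood N) (hs : IsScale N s) {u v : Pos}
    {k l : Option {w : Pos // w ∈ N}}
    (h : sc s u + offset s k + (1, 0) = sc s v + offset s l) :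
    col l = col k + 1 ∧ u + shift k = v + shift l := by
  simp only [placement_eq, Prod.mk_add_mk, add_zero, Prod.mk.injEq] at h
  have hk := col_add_one_lt hN hs k
  have hl := col_add_one_lt hN hs l
  have hk' := col_nonneg k
  obtain ⟨hc, h₁⟩ := mul_add_inj (by omega) hk (col_nonneg l) (by omega)
    ((add_assoc _ _ _).symm.trans h.1)
  exact ⟨hc.symm, Prod.ext h₁ (mul_left_cancel₀ (by have := hs.1; omega : s ≠ 0) h.2)⟩

lemma placement_north (hs : IsScale N s) {u v : Pos} {k l : Option {w : Pos // w ∈ N}} :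
    sc s u + offset s k + (0, 1) ≠ sc s v + offset s l := by
  intro h
  simp only [placement_eq, Prod.mk_add_mk, Prod.mk.injEq] at h
  have hs2 := hs.1
  have := mul_add_inj (a := 1) (b := 0) (by omega) (by omega) le_rfl (by omega)
    (h.2.trans (add_zero _).symm)
  omega

lemma eastGlue_eq_westGlue {T : Set (Tile X N)} (hN : IsNeighborhood N) (hs : IsScale N s)
    {τ : Pos → Option (Tile X N)} (hτ : IsTiling T τ) {u v : Pos} {t t' : Tile X N}
    (hu : τ u = some t) (hv : τ v = some t') {k l : Option {w : Pos // w ∈ N}}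
    (h : sc s u + offset s k + (1, 0) = sc s v + offset s l) :
    eastGlue t k = westGlue t' l := by
  obtain ⟨hc, he⟩ := placement_east hN hs h
  obtain ⟨h₁, h₂⟩ | ⟨w, hw, hw', hp, hp', rfl, rfl⟩ := col_succ hc t t'
  · rw [h₁, h₂]
  · simp only [shift, hp, hp', if_true, if_false] at he
    have hvu : v = u + w := by
      rw [← add_neg_eq_iff_eq_add, ← he]; exact add_zero u
    subst hvu
    simp [eastGlue, westGlue, hp, hp', hτ.2 u t hu w t' hv hw hw']

/-- Adjacent micro tiles placed according to a tiling have matching glues. -/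
lemma microTile_match {T : Set (Tile X N)} (hN : IsNeighborhood N) (hs : IsScale N s)
    {τ : Pos → Option (Tile X N)} (hτ : IsTiling T τ) {u v : Pos} {t t' : Tile X N}
    (hu : τ u = some t) (hv : τ v = some t') {k l : Option {w : Pos // w ∈ N}} {d : Pos}
    (h : sc s u + offset s k + d = sc s v + offset s l) (hd : d ∈ Nvn) (hd' : -d ∈ Nvn) :
    microTile t k ⟨d, hd⟩ = microTile t' l ⟨-d, hd'⟩ := by
  have hback : sc s v + offset s l + -d = sc s u + offset s k := by
    rw [← h, add_neg_cancel_right]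
  have hd₀ := hd
  simp only [Nvn, Set.mem_insert_iff, Set.mem_singleton_iff] at hd₀
  rcases hd₀ with rfl | rfl | rfl | rfl
  · exact absurd h (placement_north hs)
  · simp [microTile, eastGlue_eq_westGlue hN hs hτ hu hv h]
  · exact absurd (by simpa using hback) (placement_north (u := v) (v := u) hs)
  · simp [microTile, eastGlue_eq_westGlue hN hs hτ hv hu (by simpa using hback)]

/-- The micro tiling obtained by replacing every tile of `τ` by its micro tiles. -/
noncomputable def expand (s : ℤ) (τ : Pos → Option (Tile X N)) :
    Pos → Option (Tile (MicroGlue X N) Nvn) := fun p =>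
  if h : ∃ a u t k, τ u = some t ∧ p = sc s u + offset s k ∧ a = microTile t k
    then some h.choose else none

lemma expand_eq_some_iff (hN : IsNeighborhood N) (hs : IsScale N s)
    {τ : Pos → Option (Tile X N)} {p : Pos} {a : Tile (MicroGlue X N) Nvn} :
    expand s τ p = some a ↔
      ∃ u t k, τ u = some t ∧ p = sc s u + offset s k ∧ a = microTile t k := by
  unfold expand
  constructor
  · intro h
    split_ifs at h with h'
    obtain rfl := Option.some.inj h
    exact h'.choose_spec
  · rintro ⟨u, t, k, hu, rfl, rfl⟩
    have h' : ∃ a v t' l, τ v = some t' ∧ sc s u + offset s k = sc s v + offset s l ∧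
        a = microTile t' l := ⟨_, u, t, k, hu, rfl, rfl⟩
    rw [dif_pos h']
    obtain ⟨v, t', l, hv, hp, ha⟩ := h'.choose_spec
    obtain ⟨rfl, rfl⟩ := placement_inj hN hs hp
    rw [ha, Option.some.inj (hu.symm.trans hv)]

/-- The tile system consisting of all micro tiles of tiles of `T`. -/
def microTiles (T : Set (Tile X N)) : Set (Tile (MicroGlue X N) Nvn) :=
  {a | ∃ t ∈ T, ∃ k, a = microTile t k}

lemma isTiling_expand {T : Set (Tile X N)} (hN : IsNeighborhood N) (hs : IsScale N s)
    {τ : Pos → Option (Tile X N)} (hτ : IsTiling T τ) :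
    IsTiling (microTiles T) (expand s τ) := by
  constructor
  · intro p a h
    obtain ⟨u, t, k, hu, -, rfl⟩ := (expand_eq_some_iff hN hs).1 h
    exact ⟨t, hτ.1 u t hu, k, rfl⟩
  · intro p a h d b h' hd hd'
    obtain ⟨u, t, k, hu, rfl, rfl⟩ := (expand_eq_some_iff hN hs).1 h
    obtain ⟨v, t', l, hv, hp, rfl⟩ := (expand_eq_some_iff hN hs).1 h'
    exact microTile_match hN hs hτ hu hv hp hd hd'

/-- The tiling consisting of the tile `t` at the origin. -/
noncomputable def singleTile (t : Tile X N) : Pos → Option (Tile X N) := fun u =>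
  if u = 0 then some t else none

lemma isTiling_singleTile {T : Set (Tile X N)} (hN : IsNeighborhood N) {t : Tile X N}
    (ht : t ∈ T) : IsTiling T (singleTile t) := by
  have key : ∀ u t', singleTile t u = some t' → u = 0 ∧ t = t' := by
    intro u t' h
    simpa [singleTile] using h
  refine ⟨fun p t' h => (key p t' h).2 ▸ ht, fun p t' h w t'' h' hw _ => ?_⟩
  obtain ⟨rfl, -⟩ := key _ _ h
  obtain ⟨h₀, -⟩ := key _ _ h'
  rw [zero_add] at h₀
  subst h₀
  exact absurd hw hN.2.1

/-- The polyomino representing the tile `t`. -/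
noncomputable def poly (s : ℤ) (t : Tile X N) : Pos → Option (Tile (MicroGlue X N) Nvn) :=
  expand s (singleTile t)

lemma poly_eq_some_iff (hN : IsNeighborhood N) (hs : IsScale N s) {t : Tile X N} {p : Pos}
    {a : Tile (MicroGlue X N) Nvn} :
    poly s t p = some a ↔ ∃ k, p = offset s k ∧ a = microTile t k := by
  have h0 : sc s 0 = 0 := by simp [sc]
  rw [poly, expand_eq_some_iff hN hs]
  constructor
  · rintro ⟨u, t', k, hu, rfl, rfl⟩
    obtain ⟨rfl, rfl⟩ : u = 0 ∧ t = t' := by simpa [singleTile] using hu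
    exact ⟨k, by rw [h0, zero_add], rfl⟩
  · rintro ⟨k, rfl, rfl⟩
    exact ⟨0, t, k, by simp [singleTile], by rw [h0, zero_add], rfl⟩

lemma poly_offset (hN : IsNeighborhood N) (hs : IsScale N s) (t : Tile X N)
    (k : Option {w : Pos // w ∈ N}) : poly s t (offset s k) = some (microTile t k) :=
  (poly_eq_some_iff hN hs).2 ⟨k, rfl, rfl⟩

lemma poly_injective (hN : IsNeighborhood N) (hs : IsScale N s) :
    Function.Injective (poly (X := X) (N := N) s) := by
  intro t t' h
  have h' := congrFun h (offset s (none : Option {w : Pos // w ∈ N}))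
  rw [poly_offset hN hs, poly_offset hN hs] at h'
  exact (microTile_inj (Option.some.inj h')).1

lemma isFiniteTiling_poly {T : Set (Tile X N)} (hN : IsNeighborhood N) (hs : IsScale N s)
    {t : Tile X N} (ht : t ∈ T) : IsFiniteTiling (microTiles T) (poly s t) := by
  refine ⟨isTiling_expand hN hs (isTiling_singleTile hN ht), ?_⟩
  have : Finite {w : Pos // w ∈ N} := hN.1
  refine (Set.finite_range (offset (N := N) s)).subset fun p hp => ?_
  obtain ⟨a, ha⟩ := Option.ne_none_iff_exists'.1 hp
  obtain ⟨k, rfl, -⟩ := (poly_eq_some_iff hN hs).1 ha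
  exact ⟨k, rfl⟩

/-- The poly-tiling obtained by replacing every tile of `τ` by its polyomino. -/
noncomputable def polyTiling (s : ℤ) (τ : Pos → Option (Tile X N)) :
    Pos → Option (Pos → Option (Tile (MicroGlue X N) Nvn)) := fun u => (τ u).map (poly s)

lemma polyTiling_eq_some_iff {τ : Pos → Option (Tile X N)} {u : Pos}
    {ρ : Pos → Option (Tile (MicroGlue X N) Nvn)} :
    polyTiling s τ u = some ρ ↔ ∃ t, τ u = some t ∧ poly s t = ρ :=
  Option.map_eq_some_iff

lemma polyTiling_injective (hN : IsNeighborhood N) (hs : IsScale N s) :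
    Function.Injective (polyTiling (X := X) (N := N) s) := fun _ _ h =>
  funext fun u => Option.map_injective (poly_injective hN hs) (congrFun h u)

lemma isPolyTiling_polyTiling {T : Set (Tile X N)} (hN : IsNeighborhood N)
    (hs : IsScale N s) {τ : Pos → Option (Tile X N)} (hτ : IsTiling T τ) :
    IsPolyTiling (microTiles T) s (polyTiling s τ) := by
  simp only [IsPolyTiling, polyTiling_eq_some_iff]
  refine ⟨?_, ?_, ?_⟩
  · rintro u _ ⟨t, hu, rfl⟩
    exact isFiniteTiling_poly hN hs (hτ.1 u t hu)
  · rintro u v _ _ huv ⟨t, hu, rfl⟩ ⟨t', hv, rfl⟩ p hp q hq h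
    obtain ⟨a, ha⟩ := Option.ne_none_iff_exists'.1 hp
    obtain ⟨b, hb⟩ := Option.ne_none_iff_exists'.1 hq
    obtain ⟨k, rfl, -⟩ := (poly_eq_some_iff hN hs).1 ha
    obtain ⟨l, rfl, -⟩ := (poly_eq_some_iff hN hs).1 hb
    exact huv (placement_inj hN hs h).1
  · rintro u v _ _ ⟨t, hu, rfl⟩ ⟨t', hv, rfl⟩ p a ha q b hb hw hw'
    obtain ⟨k, rfl, rfl⟩ := (poly_eq_some_iff hN hs).1 ha
    obtain ⟨l, rfl, rfl⟩ := (poly_eq_some_iff hN hs).1 hb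
    exact microTile_match hN hs hτ hu hv (add_sub_cancel _ _) hw hw'

/-- The tiling read off the complete copies of polyominoes in a micro tiling. -/
noncomputable def readOff (T : Set (Tile X N)) (s : ℤ)
    (τ' : Pos → Option (Tile (MicroGlue X N) Nvn)) : Pos → Option (Tile X N) := fun u =>
  if h : ∃ t ∈ T, ∀ k, τ' (sc s u + offset s k) = some (microTile t k)
    then some h.choose else none

lemma readOff_eq_some_iff {T : Set (Tile X N)}
    {τ' : Pos → Option (Tile (MicroGlue X N) Nvn)} {u : Pos} {t : Tile X N} :
    readOff T s τ' u = some t ↔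
      t ∈ T ∧ ∀ k, τ' (sc s u + offset s k) = some (microTile t k) := by
  unfold readOff
  constructor
  · intro h
    split_ifs at h with h'
    obtain rfl := Option.some.inj h
    exact h'.choose_spec
  · intro h
    have h' : ∃ t ∈ T, ∀ k, τ' (sc s u + offset s k) = some (microTile t k) := ⟨t, h⟩
    rw [dif_pos h']
    have e := (h'.choose_spec.2 none).symm.trans (h.2 none)
    rw [(microTile_inj (Option.some.inj e)).1]

lemma isTiling_readOff {T : Set (Tile X N)} (hN : IsNeighborhood N)
    {τ' : Pos → Option (Tile (MicroGlue X N) Nvn)} (hτ' : IsTiling (microTiles T) τ') :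
    IsTiling T (readOff T s τ') := by
  have key : ∀ u t, readOff T s τ' u = some t → ∀ w t', readOff T s τ' (u + w) = some t' →
      ∀ (hw : w ∈ N) (hw' : -w ∈ N), IsPos w → t ⟨w, hw⟩ = t' ⟨-w, hw'⟩ := by
    intro u t h w t' h' hw hw' hp
    have hp' : ¬ IsPos (-w) := by
      rw [isPos_neg_iff fun e => hN.2.1 (e ▸ hw), not_not]
      exact hp
    have h₁ := (readOff_eq_some_iff.1 h).2 (some ⟨w, hw⟩)
    have h₂ := (readOff_eq_some_iff.1 h').2 (some ⟨-w, hw'⟩)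
    have hpos : sc s (u + w) + offset s (some ⟨-w, hw'⟩) =
        sc s u + offset s (some ⟨w, hw⟩) + (1, 0) := by
      ext <;> simp [sc, offset, shift, col, hp, hp'] <;> ring
    rw [hpos] at h₂
    have := hτ'.2 _ _ h₁ (1, 0) _ h₂ (by simp [Nvn]) (by simp [Nvn])
    simpa [microTile, eastGlue, westGlue, hp, hp'] using this
  refine ⟨fun u t h => (readOff_eq_some_iff.1 h).1, fun u t h w t' h' hw hw' => ?_⟩
  by_cases hp : IsPos w
  · exact key u t h w t' h' hw hw' hp
  · have hp' : IsPos (-w) := (isPos_neg_iff fun e => hN.2.1 (e ▸ hw)).2 hp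
    have := key (u + w) t' h' (-w) t (by simpa using h) hw' (by simpa using hw) hp'
    simpa using this.symm

lemma readOff_expand {T : Set (Tile X N)} (hN : IsNeighborhood N) (hs : IsScale N s)
    {τ : Pos → Option (Tile X N)} (hτ : IsTiling T τ) : readOff T s (expand s τ) = τ := by
  funext u
  ext t
  rw [readOff_eq_some_iff]
  constructor
  · rintro ⟨-, h⟩
    obtain ⟨v, t', l, hv, hp, ha⟩ := (expand_eq_some_iff hN hs).1 (h none)
    obtain ⟨rfl, -⟩ := placement_inj hN hs hp
    rw [(microTile_inj ha).1, hv]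
  · intro h
    exact ⟨hτ.1 u t h, fun k => (expand_eq_some_iff hN hs).2 ⟨u, t, k, h, rfl, rfl⟩⟩

/-- The simulation of `T` by its micro tiles. -/
noncomputable def microSimulation (hN : IsNeighborhood N) (hs : IsScale N s)
    (T : Set (Tile X N)) :
    TilingSimulation X (MicroGlue X N) N T (microTiles T) s where
  hs := by have := hs.1; omega
  phi t := {ρ | t ∈ T ∧ ρ = poly s t}
  phi_fin := by
    rintro t _ ⟨ht, rfl⟩
    exact isFiniteTiling_poly hN hs ht
  phi_ref := by
    rintro t _ ⟨-, rfl⟩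
    rw [← offset_none (N := N) s, poly_offset hN hs]
    exact Option.some_ne_none _
  phi_spec := by
    rintro t t' htt' _ ⟨-, rfl⟩ _ ⟨-, rfl⟩ p q a b ha hb rfl
    obtain ⟨k, -, rfl⟩ := (poly_eq_some_iff hN hs).1 ha
    obtain ⟨l, -, h⟩ := (poly_eq_some_iff hN hs).1 hb
    exact htt' (microTile_inj h).1
  chi τ' := polyTiling s (readOff T s τ')
  chi_poly τ' hτ' := isPolyTiling_polyTiling hN hs (isTiling_readOff hN hτ')
  chi_sub := by
    intro τ' u ρ h
    obtain ⟨t, ht, rfl⟩ := polyTiling_eq_some_iff.1 h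
    obtain ⟨htT, hk⟩ := readOff_eq_some_iff.1 ht
    refine ⟨⟨t, htT, htT, rfl⟩, fun p a ha => ?_⟩
    obtain ⟨k, rfl, rfl⟩ := (poly_eq_some_iff hN hs).1 ha
    exact hk k
  chi_max := by
    rintro τ' t ht _ ⟨-, rfl⟩ u h
    have hu : readOff T s τ' u = some t :=
      readOff_eq_some_iff.2 ⟨ht, fun k => h _ _ (poly_offset hN hs t k)⟩
    simp [polyTiling, hu]
  psi τ := {polyTiling s τ}
  psi_nonempty _ _ := Set.singleton_nonempty _
  psi_poly := by
    rintro τ hτ _ rfl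
    exact isPolyTiling_polyTiling hN hs hτ
  psi_dom := by
    rintro τ - _ rfl u
    simp [polyTiling]
  psi_comp := by
    rintro τ hτ _ rfl u t hu ρ hρ
    obtain ⟨t', hu', rfl⟩ := polyTiling_eq_some_iff.1 hρ
    obtain rfl := Option.some.inj (hu.symm.trans hu')
    exact ⟨hτ.1 u t hu, rfl⟩
  psi_recover τ' hτ' :=
    ⟨readOff T s τ', ⟨isTiling_readOff hN hτ', rfl⟩,
      fun _ h => (polyTiling_injective hN hs h.2).symm⟩

end Placement

/-- simulation of arbitrary-neighborhood tilings by von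
Neumann-neighborhood tilings. -/
theorem stmt10 (X : Type) [Fintype X] (N : Set Pos) (hN : IsNeighborhood N)
    (T : Set (Tile X N)) (hT : T.Finite) :
    ∃ (Xμ : Type) (_ : Fintype Xμ) (Tμ : Set (Tile Xμ Nvn)) (_ : Tμ.Finite)
      (s : ℤ) (sim : TilingSimulation X Xμ N T Tμ s),
      ∀ τ, IsTiling T τ → ∃ τ', IsTiling Tμ τ' ∧ sim.chi τ' ∈ sim.psi τ := by
  obtain ⟨s, hs⟩ := exists_isScale hN.1
  have : Finite {w : Pos // w ∈ N} := hN.1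
  have : Finite {w : Pos // w ∈ Nvn} :=
    Set.Finite.to_subtype (s := Nvn) (by simp [Nvn])
  exact ⟨MicroGlue X N, Fintype.ofFinite _, microTiles T, Set.toFinite _, s,
    microSimulation hN hs T, fun τ hτ => ⟨expand s τ, isTiling_expand hN hs hτ,
      congrArg (polyTiling s) (readOff_expand hN hs hτ)⟩⟩

end Paper
end

section
/- Let T be a tile system in an arbitrary neighborhood N, with finite set of glues X. There exist a finite glue set X_μ, a tile system T_μ in neighborhood N_vN over X_μ, a scale s ≥ 1, a polyomino assignment φ, and a tiling-simulation ψ of T by T_μ such that for every (T,N)-tiling τ: τ is total if and only if every poly-tiling in ψ(τ), viewed as a (T_μ,N_vN)-tiling via its induced tiling, is total. -/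
namespace Paper

open scoped Classical

theorem neg_mem_Nvn {d : Pos} (hd : d ∈ Nvn) : -d ∈ Nvn := by
  simp only [Nvn, Set.mem_insert_iff, Set.mem_singleton_iff] at hd ⊢
  rcases hd with rfl | rfl | rfl | rfl <;> simp

/-- A partition of the plane into the translates by `sℤ²` of one finite, possibly disconnected,
block; `owner p` is the index of the translate containing `p`. Every cell has a neighbor in its
own translate, and translates whose indices differ by an element of `N` are adjacent. -/
structure BlockPartition (N : Set Pos) (s : ℤ) where
  owner : Pos → Pos
  owner_add : ∀ u p, owner (sc s u + p) = u + owner p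
  owner_zero : owner 0 = 0
  finite : {p | owner p = 0}.Finite
  exists_internal : ∀ p, ∃ d ∈ Nvn, owner (p + d) = owner p
  exists_adjacent : ∀ w ∈ N, ∃ p, ∃ d ∈ Nvn, owner p = 0 ∧ owner (p + d) = w

/-- Cells are shifted by a whole number of blocks depending on their column modulo `s`. -/
theorem exists_blockPartition_of_shift {N : Set Pos} {s : ℤ} (hs : 2 ≤ s) (f : ℤ → Pos)
    (hf0 : f 0 = 0)
    (hf : ∀ w ∈ N, ∃ a, 0 ≤ a ∧ a + 1 < s ∧ f a = 0 ∧ f (a + 1) = -w) :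
    Nonempty (BlockPartition N s) := by
  have hs0 : s ≠ 0 := by omega
  have hspos : 0 < s := by omega
  refine ⟨⟨fun p => (p.1 / s, p.2 / s) - f (p.1 % s), ?_, ?_, ?_, ?_, ?_⟩⟩
  · rintro ⟨u, v⟩ ⟨x, y⟩
    simp only [sc, Prod.mk_add_mk, Int.mul_add_emod_self_left, Int.mul_add_ediv_left _ _ hs0]
    rw [← Prod.mk_add_mk, add_sub_assoc]
  · simp [hf0]
  · refine (((Set.finite_Ico 0 s).prod (Set.finite_Ico 0 s)).image
      fun p : Pos => (s * (f p.1).1 + p.1, s * (f p.1).2 + p.2)).subset ?_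
    rintro ⟨x, y⟩ h
    have h' := sub_eq_zero.mp h
    refine ⟨(x % s, y % s), ?_, ?_⟩
    · simp [Int.emod_nonneg _ hs0, Int.emod_lt_of_pos _ hspos]
    · simp only [← h', Int.mul_ediv_add_emod]
  · rintro ⟨x, y⟩
    have hy := Int.emod_add_mul_ediv y s
    have h0 := Int.emod_nonneg y hs0
    have h1 := Int.emod_lt_of_pos y hspos
    by_cases h : y % s = 0
    · refine ⟨(0, 1), by simp [Nvn], ?_⟩
      have : (y + 1) / s = y / s := by
        rw [Int.ediv_eq_iff_of_pos hspos]
        constructor <;> nlinarith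
      simp [this]
    · refine ⟨(0, -1), by simp [Nvn], ?_⟩
      have : (y + -1) / s = y / s := by
        rw [Int.ediv_eq_iff_of_pos hspos]
        have : 1 ≤ y % s := by omega
        constructor <;> nlinarith
      simp [this]
  · intro w hw
    obtain ⟨a, ha0, has, hfa, hfa'⟩ := hf w hw
    refine ⟨(a, 0), (1, 0), by simp [Nvn], ?_, ?_⟩
    · have has' : a < s := by omega
      simp [Int.emod_eq_of_lt ha0 has', Int.ediv_eq_zero_of_lt ha0 has', hfa]
    · simp [Int.emod_eq_of_lt (show 0 ≤ a + 1 by omega) has,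
        Int.ediv_eq_zero_of_lt (show 0 ≤ a + 1 by omega) has, hfa']

theorem exists_blockPartition {N : Set Pos} (hN : N.Finite) :
    ∃ s : ℤ, 2 ≤ s ∧ Nonempty (BlockPartition N s) := by
  let l := hN.toFinset.toList
  refine ⟨2 * l.length + 2, by omega, exists_blockPartition_of_shift (by omega)
    (fun a => if a % 2 = 0 then 0 else -(l.getD (a / 2).toNat 0)) (by simp) ?_⟩
  intro w hw
  have hwl : w ∈ l := by simpa [l] using hw
  obtain ⟨n, hn, hnw⟩ := List.getElem_of_mem hwl
  refine ⟨2 * n, by omega, by omega, by simp, ?_⟩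
  have h1 : (2 * (n : ℤ) + 1) % 2 ≠ 0 := by omega
  have h2 : ((2 * (n : ℤ) + 1) / 2).toNat = n := by omega
  rw [if_neg h1, h2, List.getD_eq_getElem l 0 hn, hnw]

namespace BlockPartition

variable {X : Type} {N : Set Pos} {s : ℤ} (B : BlockPartition N s)

/-- Glues of the simulating system: `inl t` inside a block coding `t`, and the glues of `X`
between blocks related by the neighborhood. -/
abbrev Glue (X : Type) (N : Set Pos) : Type := Tile X N ⊕ Option X

/-- The tile at cell `p` of a block coding `t`. -/
noncomputable def cell (t : Tile X N) (p : Pos) : Tile (Glue X N) Nvn := fun d =>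
  if B.owner (p + d) - B.owner p = 0 then Sum.inl t
  else if h : B.owner (p + d) - B.owner p ∈ N then Sum.inr (some (t ⟨_, h⟩))
  else Sum.inr none

/-- The polyomino coding `t`. -/
noncomputable def block (t : Tile X N) : Pos → Option (Tile (Glue X N) Nvn) := fun p =>
  if B.owner p = 0 then some (B.cell t p) else none

variable {B}

theorem block_eq_some {t : Tile X N} {p : Pos} {a : Tile (Glue X N) Nvn} :
    B.block t p = some a ↔ B.owner p = 0 ∧ B.cell t p = a := by
  simp [block]

theorem block_ne_none {t : Tile X N} {p : Pos} : B.block t p ≠ none ↔ B.owner p = 0 := by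
  simp [block]

theorem cell_of_owner_eq {t : Tile X N} {p : Pos} {d : {w // w ∈ Nvn}}
    (h : B.owner (p + d) = B.owner p) : B.cell t p d = Sum.inl t := by
  simp [cell, h]

theorem cell_of_owner_sub_mem {t : Tile X N} {p : Pos} {d : {w // w ∈ Nvn}} {w : Pos}
    (h : B.owner (p + d) - B.owner p = w) (hw0 : w ≠ 0) (hw : w ∈ N) :
    B.cell t p d = Sum.inr (some (t ⟨w, hw⟩)) := by
  subst h
  simp only [cell, if_neg hw0, dif_pos hw]

theorem cell_of_owner_sub_notMem {t : Tile X N} {p : Pos} {d : {w // w ∈ Nvn}}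
    (h0 : B.owner (p + d) - B.owner p ≠ 0) (h : B.owner (p + d) - B.owner p ∉ N) :
    B.cell t p d = Sum.inr none := by
  simp only [cell, if_neg h0, dif_neg h]

theorem cell_add (t : Tile X N) (u p : Pos) : B.cell t (sc s u + p) = B.cell t p := by
  funext d
  simp only [cell, add_assoc, B.owner_add, add_sub_add_left_eq_sub]

theorem cell_specific {t t' : Tile X N} {p q : Pos} (h : B.cell t p = B.cell t' q) :
    t = t' := by
  obtain ⟨d, hd, hdo⟩ := B.exists_internal p
  have h' := congrFun h ⟨d, hd⟩
  rw [cell_of_owner_eq hdo] at h'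
  simp only [cell] at h'
  split_ifs at h'
  exact Sum.inl.inj h'

theorem block_zero (t : Tile X N) : B.block t 0 = some (B.cell t 0) := by
  simp [block, B.owner_zero]

theorem block_injective : Function.Injective (B.block (X := X)) := fun t t' h => by
  have h0 := congrFun h 0
  rw [block_zero, block_zero] at h0
  exact cell_specific (Option.some.inj h0)

theorem isFiniteTiling_block (t : Tile X N) : IsFiniteTiling Set.univ (B.block t) := by
  refine ⟨⟨fun _ _ _ => Set.mem_univ _, ?_⟩, ?_⟩
  · intro p a hp w b hq hw hw'
    obtain ⟨hp0, rfl⟩ := block_eq_some.mp hp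
    obtain ⟨hq0, rfl⟩ := block_eq_some.mp hq
    rw [cell_of_owner_eq (by simp [hp0, hq0]), cell_of_owner_eq (by simp [hp0, hq0])]
  · simpa only [tdom, block_ne_none] using B.finite

/-- The tiling obtained by replacing every tile of `τ` by the block coding it. -/
noncomputable def expand (B : BlockPartition N s) (τ : Pos → Option (Tile X N)) :
    Pos → Option (Tile (Glue X N) Nvn) :=
  fun p => (τ (B.owner p)).map fun t => B.cell t p

theorem isTiling_expand (hN : IsNeighborhood N) {T : Set (Tile X N)}
    {τ : Pos → Option (Tile X N)} (hτ : IsTiling T τ) :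
    IsTiling Set.univ (B.expand τ) := by
  refine ⟨fun _ _ _ => Set.mem_univ _, ?_⟩
  intro p a hp d b hq hd hd'
  obtain ⟨t, ht, rfl⟩ := Option.map_eq_some_iff.mp hp
  obtain ⟨t', ht', rfl⟩ := Option.map_eq_some_iff.mp hq
  have hback : p + d + -d = p := add_neg_cancel_right p d
  by_cases h0 : B.owner (p + d) = B.owner p
  · obtain rfl : t = t' := Option.some.inj (ht.symm.trans (h0 ▸ ht'))
    rw [cell_of_owner_eq h0, cell_of_owner_eq (by simp [h0])]
  have h0s := sub_ne_zero.mpr h0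
  have hneg : B.owner (p + d + -d) - B.owner (p + d) = -(B.owner (p + d) - B.owner p) := by
    rw [hback, neg_sub]
  by_cases hw : B.owner (p + d) - B.owner p ∈ N
  · rw [cell_of_owner_sub_mem rfl h0s hw,
      cell_of_owner_sub_mem hneg (neg_ne_zero.mpr h0s) (hN.2.2 _ hw)]
    rw [hτ.2 _ t ht (B.owner (p + d) - B.owner p) t' (by rwa [add_sub_cancel]) hw
      (hN.2.2 _ hw)]
  · rw [cell_of_owner_sub_notMem h0s hw, cell_of_owner_sub_notMem]
    · rw [hneg]; exact neg_ne_zero.mpr h0s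
    · rw [hneg]; exact fun h => hw (neg_neg (B.owner (p + d) - B.owner p) ▸ hN.2.2 _ h)

/-- A family of blocks that all occur in one tiling is a poly-tiling. -/
theorem isPolyTiling_of_forall_block {τ' : Pos → Option (Tile (Glue X N) Nvn)}
    (hτ' : IsTiling Set.univ τ') {τ : Pos → Option (Tile X N)}
    (h : ∀ u t, τ u = some t → ∀ p a, B.block t p = some a → τ' (sc s u + p) = some a) :
    IsPolyTiling Set.univ s fun u => (τ u).map B.block := by
  refine ⟨?_, ?_, ?_⟩
  · intro u τu hu
    obtain ⟨t, -, rfl⟩ := Option.map_eq_some_iff.mp hu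
    exact isFiniteTiling_block t
  · intro u v τu τv huv hu hv p hp q hq heq
    obtain ⟨t, -, rfl⟩ := Option.map_eq_some_iff.mp hu
    obtain ⟨t', -, rfl⟩ := Option.map_eq_some_iff.mp hv
    have := congrArg B.owner heq
    rw [B.owner_add, B.owner_add, block_ne_none.mp hp, block_ne_none.mp hq, add_zero,
      add_zero] at this
    exact huv this
  · intro u u' τu τu' hu hu' v a ha v' a' ha' hw hw'
    obtain ⟨t, ht, rfl⟩ := Option.map_eq_some_iff.mp hu
    obtain ⟨t', ht', rfl⟩ := Option.map_eq_some_iff.mp hu'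
    exact hτ'.2 _ a (h u t ht v a ha) _ a' (by rw [add_sub_cancel]; exact h u' t' ht' v' a' ha')
      hw hw'

/-- `τ'` contains, at macro-position `u`, a complete copy of the block coding `t`. -/
def Occurs (B : BlockPartition N s) (τ' : Pos → Option (Tile (Glue X N) Nvn)) (u : Pos)
    (t : Tile X N) : Prop :=
  ∀ p a, B.block t p = some a → τ' (sc s u + p) = some a

theorem Occurs.eq_some {τ' : Pos → Option (Tile (Glue X N) Nvn)} {u : Pos} {t : Tile X N}
    (h : B.Occurs τ' u t) {p : Pos} (hp : B.owner p = u) : τ' p = some (B.cell t p) := by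
  obtain ⟨q, rfl⟩ : ∃ q, p = sc s u + q := ⟨p - sc s u, by abel⟩
  rw [B.owner_add, add_eq_left] at hp
  rw [cell_add]
  exact h q _ (block_eq_some.mpr ⟨hp, rfl⟩)

/-- The tiling of `T` read off from the complete blocks of `τ'`. -/
noncomputable def decode (B : BlockPartition N s) (T : Set (Tile X N))
    (τ' : Pos → Option (Tile (Glue X N) Nvn)) : Pos → Option (Tile X N) :=
  fun u => if h : ∃ t ∈ T, B.Occurs τ' u t then some h.choose else none

theorem decode_spec {T : Set (Tile X N)} {τ' : Pos → Option (Tile (Glue X N) Nvn)} {u : Pos}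
    {t : Tile X N} (h : B.decode T τ' u = some t) : t ∈ T ∧ B.Occurs τ' u t := by
  unfold decode at h
  split_ifs at h with h'
  exact Option.some.inj h ▸ h'.choose_spec

theorem isTiling_decode (hN : IsNeighborhood N) (T : Set (Tile X N))
    {τ' : Pos → Option (Tile (Glue X N) Nvn)} (hτ' : IsTiling Set.univ τ') :
    IsTiling T (B.decode T τ') := by
  refine ⟨fun p t h => (decode_spec h).1, ?_⟩
  intro u t ht w t' ht' hw hw'
  obtain ⟨p, d, hd, hp, hpd⟩ := B.exists_adjacent w hw
  have hw0 : w ≠ 0 := by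
    rintro rfl
    exact hN.2.1 hw
  have h1 := (decode_spec ht).2.eq_some (p := sc s u + p) (by rw [B.owner_add, hp, add_zero])
  have h2 := (decode_spec ht').2.eq_some (p := sc s u + p + d)
    (by rw [add_assoc, B.owner_add, hpd])
  have h := hτ'.2 _ _ h1 _ _ h2 hd (neg_mem_Nvn hd)
  rw [cell_of_owner_sub_mem (w := w) (by simp [add_assoc, B.owner_add, hp, hpd]) hw0 hw,
    cell_of_owner_sub_mem (w := -w) (by simp [add_assoc, B.owner_add, hp, hpd])
      (neg_ne_zero.mpr hw0) hw'] at h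
  exact Option.some.inj (Sum.inr.inj h)

theorem totalDom_iff_totalDom_induced (τ : Pos → Option (Tile X N)) :
    TotalDom τ ↔ TotalDom (induced s fun u => (τ u).map B.block) := by
  simp only [TotalDom, induced, ne_eq, dite_eq_right_iff, reduceCtorEq, imp_false, not_not]
  constructor
  · intro h p
    obtain ⟨t, ht⟩ := Option.ne_none_iff_exists'.mp (h (B.owner p))
    obtain ⟨q, hq⟩ : ∃ q, p = sc s (B.owner p) + q := ⟨p - sc s (B.owner p), by abel⟩
    have hq0 : B.owner q = 0 := by
      have := congrArg B.owner hq
      rwa [B.owner_add, left_eq_add] at this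
    exact ⟨_, B.owner p, _, q, by rw [ht]; rfl, block_eq_some.mpr ⟨hq0, rfl⟩, hq⟩
  · intro h u hu
    obtain ⟨a, u', τu, v, hu', hv, heq⟩ := h (sc s u + 0)
    obtain ⟨t, ht, rfl⟩ := Option.map_eq_some_iff.mp hu'
    have := congrArg B.owner heq
    rw [B.owner_add, B.owner_add, B.owner_zero, (block_eq_some.mp hv).1, add_zero,
      add_zero] at this
    subst this
    simp [hu] at ht

/-- The tiling-simulation given by a block partition. -/
noncomputable def simulation (B : BlockPartition N s) (hs : 1 ≤ s) (hN : IsNeighborhood N)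
    (T : Set (Tile X N)) : TilingSimulation X (Glue X N) N T Set.univ s where
  hs := hs
  phi t := {B.block t}
  phi_fin := by
    rintro t _ rfl
    exact isFiniteTiling_block t
  phi_ref := by
    rintro t _ rfl
    exact block_ne_none.mpr B.owner_zero
  phi_spec := by
    rintro t t' htt' _ rfl _ rfl p q a b ha hb rfl
    exact htt' (cell_specific ((block_eq_some.mp ha).2.trans (block_eq_some.mp hb).2.symm))
  chi τ' u := (B.decode T τ' u).map B.block
  chi_poly τ' hτ' := isPolyTiling_of_forall_block hτ' fun _ _ h => (decode_spec h).2
  chi_sub := by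
    intro τ' u σu h
    obtain ⟨t, ht, rfl⟩ := Option.map_eq_some_iff.mp h
    exact ⟨⟨t, (decode_spec ht).1, rfl⟩, (decode_spec ht).2⟩
  chi_max := by
    rintro τ' t ht _ rfl u h
    have h' : ∃ t ∈ T, B.Occurs τ' u t := ⟨t, ht, h⟩
    simp [decode, h']
  psi τ := {fun u => (τ u).map B.block}
  psi_nonempty _ _ := Set.singleton_nonempty _
  psi_poly := by
    rintro τ hτ _ rfl
    refine isPolyTiling_of_forall_block (isTiling_expand (B := B) hN hτ) ?_
    intro u t ht p a ha
    obtain ⟨hp, rfl⟩ := block_eq_some.mp ha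
    simp [expand, B.owner_add, hp, ht, cell_add]
  psi_dom := by
    rintro τ - _ rfl u
    simp
  psi_comp := by
    rintro τ - _ rfl u t ht σu h
    simpa [ht, eq_comm] using h
  psi_recover := by
    intro τ' hτ'
    refine ⟨B.decode T τ', ⟨isTiling_decode hN T hτ', rfl⟩, ?_⟩
    rintro τ ⟨-, h⟩
    funext u
    exact (Option.map_injective block_injective (congrFun h u)).symm

end BlockPartition

/-- a tiling-simulation preserving totality: a tiling is total iff
every poly-tiling in its image, viewed via its induced tiling, is total. -/
theorem stmt11 (X : Type) [Fintype X] (N : Set Pos) (hN : IsNeighborhood N)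
    (T : Set (Tile X N)) (hT : T.Finite) :
    ∃ (Xμ : Type) (_ : Fintype Xμ) (Tμ : Set (Tile Xμ Nvn)) (_ : Tμ.Finite)
      (s : ℤ) (sim : TilingSimulation X Xμ N T Tμ s),
      ∀ τ, IsTiling T τ →
        (TotalDom τ ↔ ∀ σ ∈ sim.psi τ, TotalDom (induced s σ)) := by
  obtain ⟨s, hs, ⟨B⟩⟩ := exists_blockPartition hN.1
  have : Finite {w : Pos // w ∈ N} := hN.1
  have : Finite {w : Pos // w ∈ Nvn} := by
    rw [Set.finite_coe_iff, Nvn]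
    exact Set.toFinite _
  refine ⟨BlockPartition.Glue X N, Fintype.ofFinite _, Set.univ, Set.finite_univ, s,
    B.simulation (by omega) hN T, fun τ _ => ?_⟩
  rw [B.totalDom_iff_totalDom_induced τ]
  simp [BlockPartition.simulation]

end Paper
end

section
/- Let T be a tile system in an arbitrary neighborhood N, with finite set of glues X. There exist a finite glue set X_μ, a tile system T_μ in neighborhood N_vN over X_μ, a scale s ≥ 1, a polyomino assignment φ, and a tiling-simulation ψ of T by T_μ such that for every (T,N)-tiling τ: τ is periodic if and only if at least one poly-tiling in ψ(τ), viewed as a (T_μ,N_vN)-tiling via its induced tiling, is periodic. -/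
namespace Paper

open scoped Classical

/-- A placement, modulo the scale, of one reference cell and one cell per neighbor such that
the only contacts between cells join the cell of `w` to the cell of `-w` of the neighbor `w`. -/
structure Layout (N : Set Pos) where
  scale : ℤ
  one_le : 1 ≤ scale
  neg_mem : ∀ w ∈ N, -w ∈ N
  pos : Option N → Pos
  dir : N → Pos
  dir_mem : ∀ w, dir w ∈ Nvn
  dir_ne : ∀ w, dir w ≠ (0, 1)
  pos_none : pos none = (0, 0)
  inj : ∀ u v k l, sc scale u + pos k = sc scale v + pos l → u = v ∧ k = l
  contact : ∀ u v k l, ∀ d ∈ Nvn, sc scale u + pos k + d = sc scale v + pos l →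
    ∃ w : N, k = some w ∧ l = some ⟨-w, neg_mem w w.2⟩ ∧ d = dir w ∧ v = u + w
  dir_neg : ∀ w : N, dir ⟨-w, neg_mem w w.2⟩ = -dir w
  pos_neg : ∀ w : N, sc scale w + pos (some ⟨-w, neg_mem w w.2⟩) = pos (some w) + dir w

/-- The half-plane of lexicographically positive positions. -/
def IsPositive (w : Pos) : Prop := 0 < w.1 ∨ (w.1 = 0 ∧ 0 < w.2)

theorem isPositive_neg {w : Pos} (hw : w ≠ (0, 0)) : IsPositive (-w) ↔ ¬ IsPositive w := by
  obtain ⟨x, y⟩ := w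
  simp only [IsPositive, Prod.neg_mk, ne_eq, Prod.mk.injEq] at *
  omega

theorem mem_Nvn {d : Pos} :
    d ∈ Nvn ↔ d = (0, 1) ∨ d = (1, 0) ∨ d = (0, -1) ∨ d = (-1, 0) := Iff.rfl

theorem sc_add (s : ℤ) (u v : Pos) : sc s (u + v) = sc s u + sc s v := by
  simp [sc, mul_add]

theorem int_euclid_unique {s a b x y : ℤ} (hx : 0 ≤ x) (hxs : x < s) (hy : 0 ≤ y) (hys : y < s)
    (h : s * a + x = s * b + y) : a = b ∧ x = y := by
  have hab : a = b := by
    by_contra hne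
    rcases lt_or_gt_of_ne hne with hlt | hlt <;> nlinarith
  subst hab
  exact ⟨rfl, by linarith⟩

theorem sc_euclid_unique {s x y : ℤ} {a b : Pos} {c : ℤ} (hc : 0 ≤ c) (hcs : c < s)
    (hx : 0 ≤ x) (hxs : x < s) (hy : 0 ≤ y) (hys : y < s)
    (h : sc s a + (x, c) = sc s b + (y, 0)) : a = b ∧ x = y ∧ c = 0 := by
  simp only [sc, Prod.mk_add_mk, Prod.mk.injEq] at h
  have h1 := int_euclid_unique hx hxs hy hys h.1
  have h2 := int_euclid_unique hc hcs le_rfl (by omega) h.2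
  exact ⟨Prod.ext h1.1 h2.1, h1.2, h2.2⟩

theorem exists_layout {N : Set Pos} (hN : IsNeighborhood N) : Nonempty (Layout N) := by
  obtain ⟨hfin, h0, hneg⟩ := hN
  have : Fintype N := hfin.fintype
  let n : ℤ := Fintype.card N
  let e := Fintype.equivFin N
  let s : ℤ := 3 * n + 6
  let ng : N → N := fun w => ⟨-w, hneg w w.2⟩
  have ngng : ∀ w, ng (ng w) = w := fun w => Subtype.ext (neg_neg _)
  have ngv : ∀ w, ((ng w : N) : Pos) = -w := fun w => rfl
  have hP : ∀ w : N, IsPositive (ng w) ↔ ¬ IsPositive w := fun w =>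
    isPositive_neg (fun h => h0 (h ▸ w.2))
  let c : N → ℤ := fun w => (e w : ℕ)
  have c0 : ∀ w, 0 ≤ c w := fun w => by simp [c]
  have cn : ∀ w, c w < n := fun w => by
    simp only [c, n]; exact_mod_cast (e w).2
  have cinj : ∀ w w', c w = c w' → w = w' := fun w w' h => by
    simp only [c] at h
    exact e.injective (Fin.ext (by exact_mod_cast h))
  let res : Option N → ℤ := fun k => k.elim 0
    fun w => if IsPositive w then 3 * c w + 3 else 3 * c (ng w) + 4
  let sh : Option N → Pos := fun k => k.elim 0 fun w => if IsPositive w then 0 else (w : Pos)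
  have res_pos : ∀ w : N, IsPositive w → res (some w) = 3 * c w + 3 := fun w h => by
    simp [res, h]
  have res_neg : ∀ w : N, ¬ IsPositive w → res (some w) = 3 * c (ng w) + 4 := fun w h => by
    simp [res, h]
  have sh_pos : ∀ w : N, IsPositive w → sh (some w) = 0 := fun w h => by simp [sh, h]
  have sh_neg : ∀ w : N, ¬ IsPositive w → sh (some w) = w := fun w h => by simp [sh, h]
  have res0 : ∀ k, 0 ≤ res k ∧ res k + 2 ≤ s ∧ (res k = 0 ∨ 3 ≤ res k) := by
    rintro (_ | w)
    · have hn : 0 ≤ n := Int.natCast_nonneg _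
      rw [show res none = 0 from rfl]; exact ⟨le_rfl, by simp only [s]; omega, Or.inl rfl⟩
    · have := c0 w; have := c0 (ng w); have := cn w; have := cn (ng w)
      by_cases h : IsPositive w
      · rw [res_pos w h]; simp only [s]; omega
      · rw [res_neg w h]; simp only [s]; omega
  have res_none : res none = 0 := rfl
  have res_inj : ∀ k l, res k = res l → k = l := by
    rintro (_ | w) (_ | w') h
    · rfl
    · have := c0 w'; have := c0 (ng w')
      by_cases h' : IsPositive w'
      · rw [res_pos w' h', res_none] at h; omega
      · rw [res_neg w' h', res_none] at h; omega
    · have := c0 w; have := c0 (ng w)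
      by_cases h' : IsPositive w
      · rw [res_pos w h', res_none] at h; omega
      · rw [res_neg w h', res_none] at h; omega
    · by_cases hw : IsPositive w <;> by_cases hw' : IsPositive w'
      · rw [res_pos w hw, res_pos w' hw'] at h
        rw [cinj w w' (by omega)]
      · rw [res_pos w hw, res_neg w' hw'] at h; omega
      · rw [res_neg w hw, res_pos w' hw'] at h; omega
      · rw [res_neg w hw, res_neg w' hw'] at h
        have := cinj _ _ (show c (ng w) = c (ng w') by omega)
        rw [← ngng w, this, ngng]
  -- a cell with an eastern neighbor is the cell of a positive position
  have res_succ : ∀ k l, res k + 1 = res l →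
      ∃ w : N, IsPositive w ∧ k = some w ∧ l = some (ng w) := by
    intro k l h
    rcases k with _ | w
    · have := res0 l; rw [res_none] at h; omega
    rcases l with _ | w'
    · have := res0 (some w); rw [res_none] at h; omega
    by_cases hw : IsPositive w <;> by_cases hw' : IsPositive w'
    · rw [res_pos w hw, res_pos w' hw'] at h; omega
    · rw [res_pos w hw, res_neg w' hw'] at h
      have := cinj _ _ (show c w = c (ng w') by omega)
      exact ⟨w, hw, rfl, by rw [this, ngng]⟩
    · rw [res_neg w hw, res_pos w' hw'] at h; omega
    · rw [res_neg w hw, res_neg w' hw'] at h; omega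
  let pos : Option N → Pos := fun k => sc s (sh k) + (res k, 0)
  have pos_eq : ∀ u k, sc s u + pos k = sc s (u + sh k) + (res k, 0) := fun u k => by
    simp only [pos, sc_add, add_assoc]
  have east : ∀ u v k l, sc s u + pos k + (1, 0) = sc s v + pos l →
      ∃ w : N, IsPositive w ∧ k = some w ∧ l = some (ng w) ∧ v = u + w := by
    intro u v k l h
    rw [pos_eq, pos_eq, add_assoc, Prod.mk_add_mk] at h
    have hk := res0 k; have hl := res0 l
    obtain ⟨h1, h2, -⟩ := sc_euclid_unique (by omega) (by omega) (by omega) (by omega)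
      (by omega) (by omega) h
    obtain ⟨w, hw, rfl, rfl⟩ := res_succ k l h2
    refine ⟨w, hw, rfl, rfl, ?_⟩
    rw [sh_pos w hw, sh_neg (ng w) (by rw [hP]; exact not_not.2 hw), ngv] at h1
    rw [← add_zero u, h1, neg_add_cancel_right]
  have north : ∀ u v k l, sc s u + pos k + (0, 1) ≠ sc s v + pos l := by
    intro u v k l h
    rw [pos_eq, pos_eq, add_assoc, Prod.mk_add_mk] at h
    have hk := res0 k; have hl := res0 l
    obtain ⟨-, -, h3⟩ := sc_euclid_unique (by omega) (by omega) (by omega) (by omega)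
      (by omega) (by omega) h
    omega
  refine ⟨{
    scale := s
    one_le := by simp only [s]; omega
    neg_mem := hneg
    pos := pos
    dir := fun w => if IsPositive w then (1, 0) else (-1, 0)
    dir_mem := fun w => by split_ifs <;> simp [mem_Nvn]
    dir_ne := fun w => by split_ifs <;> simp
    pos_none := by simp [pos, sh, res, sc]
    inj := ?_
    contact := ?_
    dir_neg := ?_
    pos_neg := ?_ }⟩
  · intro u v k l h
    rw [pos_eq, pos_eq] at h
    have hk := res0 k; have hl := res0 l
    obtain ⟨h1, h2, -⟩ := sc_euclid_unique le_rfl (by omega) (by omega) (by omega)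
      (by omega) (by omega) h
    obtain rfl := res_inj k l h2
    exact ⟨add_right_cancel h1, rfl⟩
  · intro u v k l d hd h
    rcases mem_Nvn.1 hd with rfl | rfl | rfl | rfl
    · exact absurd h (north u v k l)
    · obtain ⟨w, hw, rfl, rfl, hv⟩ := east u v k l h
      exact ⟨w, rfl, rfl, by simp [hw], hv⟩
    · refine absurd ?_ (north v u l k)
      rw [← h, add_assoc]; simp
    · obtain ⟨w, hw, rfl, rfl, hv⟩ := east v u l k (by rw [← h, add_assoc]; simp)
      have hnw : ¬ IsPositive (ng w) := by rw [hP]; exact not_not.2 hw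
      exact ⟨ng w, rfl, congrArg some (ngng w).symm, by simp [hnw], by rw [hv, ngv, add_neg_cancel_right]⟩
  · intro w
    have := hP w
    by_cases hw : IsPositive w
    · have h' : ¬ IsPositive (-(w : Pos)) := fun h => this.1 h hw
      simp [hw, h']
    · have h' : IsPositive (-(w : Pos)) := this.2 hw
      simp [hw, h']
  · intro w
    change sc s w + pos (some (ng w)) = _
    rw [pos_eq]
    by_cases hw : IsPositive w
    · have hnw : ¬ IsPositive (ng w) := by rw [hP]; exact not_not.2 hw
      simp only [pos]
      rw [sh_neg _ hnw, sh_pos _ hw, res_neg _ hnw, res_pos _ hw, ngng, ngv, add_neg_cancel,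
        if_pos hw]
      ext <;> simp only [Prod.fst_add, Prod.snd_add] <;> ring
    · have hnw : IsPositive (ng w) := (hP w).2 hw
      simp only [pos]
      rw [sh_pos _ hnw, sh_neg _ hw, res_pos _ hnw, res_neg _ hw, add_zero, if_neg hw]
      ext <;> simp only [Prod.fst_add, Prod.snd_add] <;> ring

section Simulation

variable {X : Type} {N : Set Pos}

/-- Glues of the simulating system: either the identity of a cell, or a simulated glue. -/
abbrev CellGlue (X : Type) (N : Set Pos) : Type := (Tile X N × Option N) ⊕ X

namespace Layout

variable (L : Layout N)

/-- The cell `k` of the polyomino of `t`: it shows the glue `t w` towards the cell it has to touch,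
and its own identity on all other sides. -/
noncomputable def cell (t : Tile X N) : Option N → Tile (CellGlue X N) Nvn
  | none => fun _ => Sum.inl (t, none)
  | some w => fun d => if (d : Pos) = L.dir w then Sum.inr (t w) else Sum.inl (t, some w)

theorem cell_inj {t t' : Tile X N} {k l : Option N} (h : L.cell t k = L.cell t' l) :
    t = t' ∧ k = l := by
  have key : ∀ (t : Tile X N) k, L.cell t k ⟨(0, 1), Or.inl rfl⟩ = Sum.inl (t, k) := by
    rintro t (_ | w)
    · rfl
    · simp [cell, (L.dir_ne w).symm]
  have := congrFun h ⟨(0, 1), Or.inl rfl⟩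
  rw [key, key] at this
  simpa using this

theorem cell_dir (t : Tile X N) (w : N) (d : {d // d ∈ Nvn}) (hd : (d : Pos) = L.dir w) :
    L.cell t (some w) d = Sum.inr (t w) := by
  simp [cell, hd]

/-- The simulating tile system, consisting of all cells. -/
def cells (X : Type) (L : Layout N) : Set (Tile (CellGlue X N) Nvn) :=
  Set.range fun tk : Tile X N × Option N => L.cell tk.1 tk.2

/-- The polyomino representing the tile `t`. -/
noncomputable def poly (t : Tile X N) : Pos → Option (Tile (CellGlue X N) Nvn) := fun p =>
  if h : ∃ k, p = L.pos k then some (L.cell t h.choose) else none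

theorem pos_inj {k l : Option N} (h : L.pos k = L.pos l) : k = l :=
  (L.inj 0 0 k l (by rw [h])).2

theorem poly_eq_some {t : Tile X N} {p : Pos} {a : Tile (CellGlue X N) Nvn} :
    L.poly t p = some a ↔ ∃ k, p = L.pos k ∧ L.cell t k = a := by
  unfold poly
  split_ifs with h
  · rw [Option.some_inj]
    refine ⟨fun ha => ⟨_, h.choose_spec, ha⟩, ?_⟩
    rintro ⟨k, hk, rfl⟩
    rw [L.pos_inj (h.choose_spec.symm.trans hk)]
  · simp only [false_iff]
    rintro ⟨k, hk, -⟩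
    exact h ⟨k, hk⟩

theorem poly_pos (t : Tile X N) (k : Option N) : L.poly t (L.pos k) = some (L.cell t k) :=
  L.poly_eq_some.2 ⟨k, rfl, rfl⟩

theorem poly_inj {t t' : Tile X N} (h : L.poly t = L.poly t') : t = t' := by
  have := congrFun h (L.pos none)
  rw [poly_pos, poly_pos, Option.some_inj] at this
  exact (L.cell_inj this).1

/-- The poly-tiling representing the tiling `τ`. -/
noncomputable def encode (τ : Pos → Option (Tile X N)) :
    Pos → Option (Pos → Option (Tile (CellGlue X N) Nvn)) := fun u => (τ u).map L.poly

theorem encode_eq_some {τ : Pos → Option (Tile X N)} {u : Pos}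
    {σ : Pos → Option (Tile (CellGlue X N) Nvn)} :
    L.encode τ u = some σ ↔ ∃ t, τ u = some t ∧ L.poly t = σ := by
  simp [encode]

theorem encode_injective : Function.Injective (L.encode (X := X)) := by
  intro τ τ' h
  funext u
  exact Option.map_injective (fun _ _ => L.poly_inj) (congrFun h u)

theorem coe_ne_zero (L : Layout N) (w : N) : (w : Pos) ≠ 0 := by
  intro hw
  have h := L.pos_neg w
  have hneg : (⟨-w, L.neg_mem w w.2⟩ : N) = w := Subtype.ext (by simp [hw])
  rw [hneg, hw] at h
  have hsc : sc L.scale 0 = 0 := by simp [sc]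
  have hd : L.dir w = 0 := by simpa [hsc] using h.symm
  have hm := L.dir_mem w
  rw [hd] at hm
  simp [mem_Nvn, Prod.ext_iff] at hm

theorem isFiniteTiling_poly [Finite N] (t : Tile X N) :
    IsFiniteTiling (L.cells X) (L.poly t) := by
  refine ⟨⟨?_, ?_⟩, ?_⟩
  · intro p a hp
    obtain ⟨k, -, rfl⟩ := L.poly_eq_some.1 hp
    exact ⟨(t, k), rfl⟩
  · intro p a hp d b hq hd _
    obtain ⟨k, rfl, rfl⟩ := L.poly_eq_some.1 hp
    obtain ⟨l, hl, rfl⟩ := L.poly_eq_some.1 hq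
    obtain ⟨w, -, -, -, hw⟩ := L.contact 0 0 k l d hd (by rw [add_assoc, hl])
    exact absurd (by simpa using hw.symm) (L.coe_ne_zero w)
  · refine (Set.finite_range L.pos).subset fun p hp => ?_
    obtain ⟨a, ha⟩ := Option.ne_none_iff_exists'.1 hp
    obtain ⟨k, rfl, -⟩ := L.poly_eq_some.1 ha
    exact ⟨k, rfl⟩

theorem isPolyTiling_encode [Finite N] {T : Set (Tile X N)} {τ : Pos → Option (Tile X N)}
    (hτ : IsTiling T τ) : IsPolyTiling (L.cells X) L.scale (L.encode τ) := by
  refine ⟨?_, ?_, ?_⟩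
  · intro u σ hu
    obtain ⟨t, -, rfl⟩ := L.encode_eq_some.1 hu
    exact L.isFiniteTiling_poly t
  · intro u v σ σ' huv hu hv p hp q hq h
    obtain ⟨t, -, rfl⟩ := L.encode_eq_some.1 hu
    obtain ⟨t', -, rfl⟩ := L.encode_eq_some.1 hv
    obtain ⟨a, ha⟩ := Option.ne_none_iff_exists'.1 hp
    obtain ⟨b, hb⟩ := Option.ne_none_iff_exists'.1 hq
    obtain ⟨k, rfl, -⟩ := L.poly_eq_some.1 ha
    obtain ⟨l, rfl, -⟩ := L.poly_eq_some.1 hb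
    exact huv (L.inj _ _ _ _ h).1
  · intro u v σ σ' hu hv p a hp q b hq hd hd'
    obtain ⟨t, ht, rfl⟩ := L.encode_eq_some.1 hu
    obtain ⟨t', ht', rfl⟩ := L.encode_eq_some.1 hv
    obtain ⟨k, rfl, rfl⟩ := L.poly_eq_some.1 hp
    obtain ⟨l, rfl, rfl⟩ := L.poly_eq_some.1 hq
    obtain ⟨w, rfl, rfl, hdw, rfl⟩ := L.contact u v k l _ hd (add_sub_cancel _ _)
    rw [L.cell_dir t w _ hdw, L.cell_dir t' _ _ (by rw [L.dir_neg, ← hdw]),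
      hτ.2 u t ht w t' ht' w.2 (L.neg_mem w w.2)]

/-- The tile of `T` at `u` is the one whose polyomino is entirely present at `u`. -/
noncomputable def decode (T : Set (Tile X N)) (τ' : Pos → Option (Tile (CellGlue X N) Nvn)) :
    Pos → Option (Tile X N) := fun u =>
  if h : ∃ t ∈ T, ∀ k, τ' (sc L.scale u + L.pos k) = some (L.cell t k) then some h.choose else none

theorem decode_eq_some {T : Set (Tile X N)} {τ' : Pos → Option (Tile (CellGlue X N) Nvn)}
    {u : Pos} {t : Tile X N} : L.decode T τ' u = some t ↔
      t ∈ T ∧ ∀ k, τ' (sc L.scale u + L.pos k) = some (L.cell t k) := by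
  unfold decode
  split_ifs with h
  · rw [Option.some_inj]
    refine ⟨fun ht => ht ▸ h.choose_spec, fun ht => ?_⟩
    have := (h.choose_spec.2 none).symm.trans (ht.2 none)
    exact (L.cell_inj (Option.some_inj.1 this)).1
  · simp only [false_iff]
    exact fun ht => h ⟨t, ht⟩

theorem isTiling_decode {T : Set (Tile X N)} {τ' : Pos → Option (Tile (CellGlue X N) Nvn)}
    (h : IsTiling (L.cells X) τ') : IsTiling T (L.decode T τ') := by
  refine ⟨fun u t ht => (L.decode_eq_some.1 ht).1, ?_⟩
  intro u t ht w t' ht' hw hw'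
  have h1 := (L.decode_eq_some.1 ht).2 (some ⟨w, hw⟩)
  have h2 := (L.decode_eq_some.1 ht').2 (some ⟨-w, hw'⟩)
  have hpos := L.pos_neg ⟨w, hw⟩
  have hdir := L.dir_neg ⟨w, hw⟩
  dsimp only at hpos hdir
  rw [sc_add, add_assoc, hpos, ← add_assoc] at h2
  have h3 := h.2 _ _ h1 _ _ h2 (L.dir_mem _) (neg_mem_Nvn (L.dir_mem _))
  rw [L.cell_dir _ _ _ rfl, L.cell_dir _ _ _ hdir.symm] at h3
  exact Sum.inr_injective h3

/-- The simulation of `T` by cells, each tiling being represented by exactly one poly-tiling. -/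
noncomputable def simulation [Finite N] (T : Set (Tile X N)) :
    TilingSimulation X (CellGlue X N) N T (L.cells X) L.scale where
  hs := L.one_le
  phi t := {L.poly t}
  phi_fin := by
    rintro t _ rfl
    exact L.isFiniteTiling_poly t
  phi_ref := by
    rintro t _ rfl
    rw [← L.pos_none, poly_pos]
    exact Option.some_ne_none _
  phi_spec := by
    rintro t t' hne _ rfl _ rfl p q a b ha hb rfl
    obtain ⟨k, -, rfl⟩ := L.poly_eq_some.1 ha
    obtain ⟨l, -, hl⟩ := L.poly_eq_some.1 hb
    exact hne (L.cell_inj hl).1.symm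
  chi τ' := L.encode (L.decode T τ')
  chi_poly τ' h := L.isPolyTiling_encode (L.isTiling_decode (T := T) h)
  chi_sub := by
    intro τ' u σ hu
    obtain ⟨t, ht, rfl⟩ := L.encode_eq_some.1 hu
    obtain ⟨htT, hk⟩ := L.decode_eq_some.1 ht
    refine ⟨⟨t, htT, rfl⟩, fun p a hp => ?_⟩
    obtain ⟨k, rfl, rfl⟩ := L.poly_eq_some.1 hp
    exact hk k
  chi_max := by
    rintro τ' t ht _ rfl u h
    have : L.decode T τ' u = some t :=
      L.decode_eq_some.2 ⟨ht, fun k => h _ _ (L.poly_pos t k)⟩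
    simp [encode, this]
  psi τ := {L.encode τ}
  psi_nonempty _ _ := Set.singleton_nonempty _
  psi_poly := by
    rintro τ hτ _ rfl
    exact L.isPolyTiling_encode hτ
  psi_dom := by
    rintro τ hτ _ rfl u
    simp [encode]
  psi_comp := by
    rintro τ hτ _ rfl u t ht σ hσ
    obtain ⟨t', ht', rfl⟩ := L.encode_eq_some.1 hσ
    rw [ht, Option.some_inj] at ht'
    rw [ht']
    rfl
  psi_recover τ' h :=
    ⟨L.decode T τ', ⟨L.isTiling_decode h, rfl⟩, fun _ hτ => (L.encode_injective hτ.2).symm⟩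

theorem induced_encode_eq_some {τ : Pos → Option (Tile X N)} {p : Pos}
    {a : Tile (CellGlue X N) Nvn} : induced L.scale (L.encode τ) p = some a ↔
      ∃ u t k, τ u = some t ∧ p = sc L.scale u + L.pos k ∧ L.cell t k = a := by
  have key : ∀ b, (∃ u τu v, L.encode τ u = some τu ∧ τu v = some b ∧ p = sc L.scale u + v) ↔
      ∃ u t k, τ u = some t ∧ p = sc L.scale u + L.pos k ∧ L.cell t k = b := by
    intro b
    constructor
    · rintro ⟨u, σ, v, hu, hv, hp⟩
      obtain ⟨t, ht, rfl⟩ := L.encode_eq_some.1 hu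
      obtain ⟨k, rfl, hk⟩ := L.poly_eq_some.1 hv
      exact ⟨u, t, k, ht, hp, hk⟩
    · rintro ⟨u, t, k, ht, hp, rfl⟩
      exact ⟨u, L.poly t, L.pos k, L.encode_eq_some.2 ⟨t, ht, rfl⟩, L.poly_pos t k, hp⟩
  unfold induced
  simp only [key]
  split_ifs with h
  · rw [Option.some_inj]
    refine ⟨fun ha => ha ▸ h.choose_spec, ?_⟩
    rintro ⟨u, t, k, ht, hp, rfl⟩
    obtain ⟨u', t', k', ht', hp', ha'⟩ := h.choose_spec
    obtain ⟨rfl, rfl⟩ := L.inj _ _ _ _ (hp.symm.trans hp')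
    rw [ht, Option.some_inj] at ht'
    rw [← ha', ht']
  · simp only [false_iff]
    exact fun ha => h ⟨a, ha⟩

theorem periodicT_encode {τ : Pos → Option (Tile X N)} :
    PeriodicT τ ↔ PeriodicT (induced L.scale (L.encode τ)) := by
  have hs := L.one_le
  constructor
  · rintro ⟨ph, pv, hph, hpv, h⟩
    refine ⟨L.scale * ph, L.scale * pv, by positivity, by positivity, ?_⟩
    intro p a b hp hq
    obtain ⟨c, hc⟩ := Option.ne_none_iff_exists'.1 hp
    obtain ⟨d, hd⟩ := Option.ne_none_iff_exists'.1 hq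
    obtain ⟨u, t, k, ht, rfl, rfl⟩ := L.induced_encode_eq_some.1 hc
    obtain ⟨v, t', l, ht', hv, rfl⟩ := L.induced_encode_eq_some.1 hd
    obtain ⟨rfl, rfl⟩ := L.inj (u.1 + a * ph, u.2 + b * pv) v k l (by
      rw [← hv]; ext <;> simp [sc] <;> ring)
    have := h u a b (by simp [ht]) (by simp [ht'])
    rw [ht, ht', Option.some_inj] at this
    rw [hc, hd, this]
  · rintro ⟨ph, pv, hph, hpv, h⟩
    refine ⟨ph, pv, hph, hpv, ?_⟩
    intro u a b hu hv
    obtain ⟨t, ht⟩ := Option.ne_none_iff_exists'.1 hu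
    obtain ⟨t', ht'⟩ := Option.ne_none_iff_exists'.1 hv
    have h1 := L.induced_encode_eq_some.2 ⟨u, t, none, ht, rfl, rfl⟩
    have h2 := L.induced_encode_eq_some.2 ⟨_, t', none, ht', rfl, rfl⟩
    have hpos : sc L.scale (u.1 + a * ph, u.2 + b * pv) + L.pos none =
        ((sc L.scale u + L.pos none).1 + (L.scale * a) * ph,
          (sc L.scale u + L.pos none).2 + (L.scale * b) * pv) := by
      ext <;> simp [sc] <;> ring
    rw [hpos] at h2
    have := h _ (L.scale * a) (L.scale * b) (by rw [h1]; simp) (by rw [h2]; simp)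
    rw [h1, h2, Option.some_inj] at this
    rw [ht, ht', (L.cell_inj this).1]

end Layout

end Simulation

/-- a tiling-simulation preserving periodicity: a tiling is periodic
iff at least one poly-tiling in its image, viewed via its induced tiling, is
periodic. -/
theorem stmt12 (X : Type) [Fintype X] (N : Set Pos) (hN : IsNeighborhood N)
    (T : Set (Tile X N)) (hT : T.Finite) :
    ∃ (Xμ : Type) (_ : Fintype Xμ) (Tμ : Set (Tile Xμ Nvn)) (_ : Tμ.Finite)
      (s : ℤ) (sim : TilingSimulation X Xμ N T Tμ s),
      ∀ τ, IsTiling T τ →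
        (PeriodicT τ ↔ ∃ σ ∈ sim.psi τ, PeriodicT (induced s σ)) := by
  obtain ⟨L⟩ := exists_layout hN
  have : Finite N := hN.1
  have : Finite {w // w ∈ N} := hN.1
  have : Finite (Tile X N) := inferInstanceAs (Finite ({w // w ∈ N} → X))
  refine ⟨CellGlue X N, Fintype.ofFinite _, L.cells X, Set.finite_range _, L.scale, L.simulation T,
    fun τ _ => ?_⟩
  rw [L.periodicT_encode]
  exact ⟨fun h => ⟨_, rfl, h⟩, fun ⟨_, hσ, h⟩ => hσ ▸ h⟩

end Paper
end

section
/- Let T be a tile system in an arbitrary vertical neighborhood N, with finite set of glues X. There exist a finite glue set X_μ, a tile system T_μ in neighborhood N_vN over X_μ, a scale s ≥ 1, a polyomino assignment φ, and a tiling-simulation ψ of T by T_μ such that for every (T,N)-tiling τ: τ is column convex if and only if every poly-tiling in ψ(τ), viewed as a (T_μ,N_vN)-tiling via its induced tiling, is column convex. -/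
namespace Paper

open scoped Classical

/-- Column offset (in units of the scale) of the macro tile: even columns stay in place,
column `2 * i + 1` is shifted up by `i + 1` blocks. -/
def shear (x : ℤ) : ℤ := if x % 2 = 1 then x / 2 + 1 else 0

/-- The macro position whose macro tile covers the cell `p`. -/
def owner (s : ℤ) (p : Pos) : Pos := (p.1 / s, p.2 / s - shear (p.1 % s))

/-- Glues of the simulating system: trivial, an internal glue naming the simulated tile,
or a simulated glue. -/
abbrev MacroGlue (X : Type) (N : Set Pos) : Type := Option (Tile X N ⊕ X)

noncomputable def simGlue {X : Type} {N : Set Pos} (t : Tile X N) (v : Pos) :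
    MacroGlue X N :=
  if h : v ∈ N then some (Sum.inr (t ⟨v, h⟩)) else none

/-- The tile at column `x` and height `y` (within its block) of the macro tile of `t`. -/
noncomputable def cell {X : Type} {N : Set Pos} (s : ℤ) (t : Tile X N) (x y : ℤ) :
    Tile (MacroGlue X N) Nvn := fun w =>
  if w.1 = (0, 1) then (if y = s - 1 then none else some (Sum.inl t))
  else if w.1 = (0, -1) then (if y = 0 then none else some (Sum.inl t))
  else if w.1 = (1, 0) then (if x % 2 = 0 then simGlue t (0, -(x / 2 + 1)) else none)
  else (if x % 2 = 1 then simGlue t (0, x / 2 + 1) else none)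

/-- The macro tile simulating `t`. -/
noncomputable def macroTile {X : Type} {N : Set Pos} (s : ℤ) (t : Tile X N) :
    Pos → Option (Tile (MacroGlue X N) Nvn) := fun p =>
  if owner s p = (0, 0) then some (cell s t (p.1 % s) (p.2 % s)) else none

/-- The poly-tiling replacing each tile by its macro tile. -/
noncomputable def macroTiling {X : Type} {N : Set Pos} (s : ℤ)
    (τ : Pos → Option (Tile X N)) : Pos → Option (Pos → Option (Tile (MacroGlue X N) Nvn)) :=
  fun u => (τ u).map (macroTile s)

/-- A complete copy of the macro tile of `t` occurs in `τ'` at macro position `u`. -/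
def Occurs {X : Type} {N : Set Pos} (s : ℤ) (t : Tile X N)
    (τ' : Pos → Option (Tile (MacroGlue X N) Nvn)) (u : Pos) : Prop :=
  ∀ p a, macroTile s t p = some a → τ' (sc s u + p) = some a

/-- The tiling simulated by `τ'`. -/
noncomputable def readTiling {X : Type} {N : Set Pos} (s : ℤ) (T : Set (Tile X N))
    (τ' : Pos → Option (Tile (MacroGlue X N) Nvn)) : Pos → Option (Tile X N) := fun u =>
  if h : ∃ t ∈ T, Occurs s t τ' u then some h.choose else none

lemma emod_succ_cases {s : ℤ} (hs : 0 < s) (a : ℤ) :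
    (a % s = s - 1 ∧ (a + 1) % s = 0 ∧ (a + 1) / s = a / s + 1) ∨
      (a % s < s - 1 ∧ (a + 1) % s = a % s + 1 ∧ (a + 1) / s = a / s) := by
  have h1 := Int.emod_nonneg a hs.ne'
  have h2 := Int.emod_lt_of_pos a hs
  have h3 := Int.emod_add_mul_ediv a s
  rcases eq_or_ne (a % s) (s - 1) with h | h
  · left
    have := (Int.ediv_emod_unique (a := a + 1) (b := s) (r := 0) (q := a / s + 1) hs).2
      ⟨by linarith, le_rfl, hs⟩
    exact ⟨h, this.2, this.1⟩
  · right
    have h4 : a % s < s - 1 := by omega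
    have := (Int.ediv_emod_unique (a := a + 1) (b := s) (r := a % s + 1) (q := a / s) hs).2
      ⟨by linarith, by omega, by omega⟩
    exact ⟨h4, this.2, this.1⟩

lemma sc_add_emod_fst (s : ℤ) (u p : Pos) : (sc s u + p).1 % s = p.1 % s := by
  simp [sc]

lemma sc_add_emod_snd (s : ℤ) (u p : Pos) : (sc s u + p).2 % s = p.2 % s := by
  simp [sc]

lemma owner_sc_add {s : ℤ} (hs : 0 < s) (u p : Pos) :
    owner s (sc s u + p) = u + owner s p := by
  have h1 : (s * u.1 + p.1) / s = u.1 + p.1 / s := by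
    rw [add_comm, Int.add_mul_ediv_left _ _ hs.ne', add_comm]
  have h2 : (s * u.2 + p.2) / s = u.2 + p.2 / s := by
    rw [add_comm, Int.add_mul_ediv_left _ _ hs.ne', add_comm]
  ext
  · simpa [owner, sc] using h1
  · simp only [owner, sc, Prod.snd_add, Prod.fst_add, h2, Int.mul_add_emod_self_left]
    ring

lemma macroTile_eq_some {X : Type} {N : Set Pos} {s : ℤ} {t : Tile X N} {p : Pos}
    {a : Tile (MacroGlue X N) Nvn} :
    macroTile s t p = some a ↔ owner s p = (0, 0) ∧ cell s t (p.1 % s) (p.2 % s) = a := by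
  unfold macroTile
  split_ifs with h <;> simp [h]

lemma macroTile_ne_none {X : Type} {N : Set Pos} {s : ℤ} {t : Tile X N} {p : Pos} :
    macroTile s t p ≠ none ↔ owner s p = (0, 0) := by
  unfold macroTile
  split_ifs with h <;> simp [h]

lemma macroTile_zero {X : Type} {N : Set Pos} (s : ℤ) (t : Tile X N) :
    macroTile s t (0, 0) ≠ none :=
  macroTile_ne_none.2 (by simp [owner, shear])

lemma north_mem : ((0, 1) : Pos) ∈ Nvn := by simp [Nvn]
lemma south_mem : ((0, -1) : Pos) ∈ Nvn := by simp [Nvn]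
lemma east_mem : ((1, 0) : Pos) ∈ Nvn := by simp [Nvn]
lemma west_mem : ((-1, 0) : Pos) ∈ Nvn := by simp [Nvn]

section Cell

variable {X : Type} {N : Set Pos} (s : ℤ) (t : Tile X N) (x y : ℤ)

lemma cell_north :
    cell s t x y ⟨(0, 1), north_mem⟩ = if y = s - 1 then none else some (Sum.inl t) := by
  simp [cell]

lemma cell_south :
    cell s t x y ⟨(0, -1), south_mem⟩ = if y = 0 then none else some (Sum.inl t) := by
  simp [cell]

lemma cell_east :
    cell s t x y ⟨(1, 0), east_mem⟩ =
      if x % 2 = 0 then simGlue t (0, -(x / 2 + 1)) else none := by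
  simp [cell]

lemma cell_west :
    cell s t x y ⟨(-1, 0), west_mem⟩ =
      if x % 2 = 1 then simGlue t (0, x / 2 + 1) else none := by
  simp [cell]

end Cell

/-- The cells of a macro tile determine the simulated tile. -/
lemma eq_of_cell_eq {X : Type} {N : Set Pos} {s : ℤ} (hs : 2 ≤ s) {t t' : Tile X N}
    {x y x' y' : ℤ} (h : cell s t x y = cell s t' x' y') : t = t' := by
  have h1 := congrFun h ⟨(0, 1), north_mem⟩
  have h2 := congrFun h ⟨(0, -1), south_mem⟩
  rw [cell_north, cell_north] at h1
  rw [cell_south, cell_south] at h2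
  by_cases hy : y = 0
  · rw [if_neg (by omega)] at h1
    split_ifs at h1
    simpa using h1
  · rw [if_neg hy] at h2
    split_ifs at h2
    simpa using h2

lemma macroTile_injective {X : Type} {N : Set Pos} {s : ℤ} (hs : 2 ≤ s) :
    Function.Injective (macroTile (X := X) (N := N) s) := by
  intro t t' h
  obtain ⟨a, ha⟩ := Option.ne_none_iff_exists'.1 (macroTile_zero s t)
  have ha' := ha
  rw [h] at ha'
  exact eq_of_cell_eq hs ((macroTile_eq_some.1 ha).2.trans (macroTile_eq_some.1 ha').2.symm)

section Matching

variable {X : Type} {N : Set Pos} {T : Set (Tile X N)} {n : ℤ}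
  {τ : Pos → Option (Tile X N)}

lemma cell_north_eq_south (hn : 1 ≤ n) {p : Pos} {t t' : Tile X N}
    (h : τ (owner (2 * n) p) = some t)
    (h' : τ (owner (2 * n) (p + (0, 1))) = some t') :
    cell (2 * n) t (p.1 % (2 * n)) (p.2 % (2 * n)) ⟨(0, 1), north_mem⟩ =
      cell (2 * n) t' ((p + (0, 1)).1 % (2 * n)) ((p + (0, 1)).2 % (2 * n))
        ⟨(0, -1), south_mem⟩ := by
  obtain ⟨a, b⟩ := p
  rw [cell_north, cell_south]
  simp only [owner, Prod.mk_add_mk, add_zero] at h h' ⊢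
  have h0 := Int.emod_nonneg b (b := 2 * n) (by omega)
  rcases emod_succ_cases (s := 2 * n) (by omega) b with ⟨h1, h2, -⟩ | ⟨h1, h2, h3⟩
  · rw [if_pos h1, if_pos h2]
  · rw [if_neg (by omega), if_neg (by omega)]
    rw [h3, h] at h'
    rw [Option.some.inj h']

lemma cell_east_eq_west (hN : IsNeighborhood N) (hτ : IsTiling T τ) (hn : 1 ≤ n) {p : Pos}
    {t t' : Tile X N} (h : τ (owner (2 * n) p) = some t)
    (h' : τ (owner (2 * n) (p + (1, 0))) = some t') :
    cell (2 * n) t (p.1 % (2 * n)) (p.2 % (2 * n)) ⟨(1, 0), east_mem⟩ =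
      cell (2 * n) t' ((p + (1, 0)).1 % (2 * n)) ((p + (1, 0)).2 % (2 * n))
        ⟨(-1, 0), west_mem⟩ := by
  obtain ⟨a, b⟩ := p
  rw [cell_east, cell_west]
  simp only [owner, Prod.mk_add_mk, add_zero] at h h' ⊢
  have h0 := Int.emod_nonneg a (b := 2 * n) (by omega)
  rcases emod_succ_cases (s := 2 * n) (by omega) a with ⟨h1, h2, -⟩ | ⟨h1, h2, h3⟩
  · rw [if_neg (by omega), if_neg (by omega)]
  by_cases hpar : a % (2 * n) % 2 = 0
  · rw [h2, if_pos hpar, if_pos (by omega),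
      show (a % (2 * n) + 1) / 2 = a % (2 * n) / 2 by omega]
    rw [shear, if_neg (by omega)] at h
    rw [h2, h3, shear, if_pos (by omega),
      show (a % (2 * n) + 1) / 2 = a % (2 * n) / 2 by omega] at h'
    generalize a % (2 * n) / 2 + 1 = k at *
    unfold simGlue
    by_cases hk : ((0, k) : Pos) ∈ N
    · have hk' : ((0, -k) : Pos) ∈ N := by simpa using hN.2.2 _ hk
      rw [dif_pos hk, dif_pos hk']
      have := hτ.2 _ _ h' (0, k) t (by rw [← h]; congr 1; ext <;> simp) hk (by simpa using hk')
      rw [this]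
      simp
    · have hk' : ((0, -k) : Pos) ∉ N := fun hc => hk (by simpa using hN.2.2 _ hc)
      rw [dif_neg hk, dif_neg hk']
  · rw [if_neg hpar, if_neg (by omega)]

lemma cell_matches (hN : IsNeighborhood N) (hτ : IsTiling T τ) (hn : 1 ≤ n) {p q w : Pos}
    {t t' : Tile X N} (hq : p + w = q) (h : τ (owner (2 * n) p) = some t)
    (h' : τ (owner (2 * n) q) = some t') (hw : w ∈ Nvn) (hw' : -w ∈ Nvn) :
    cell (2 * n) t (p.1 % (2 * n)) (p.2 % (2 * n)) ⟨w, hw⟩ =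
      cell (2 * n) t' (q.1 % (2 * n)) (q.2 % (2 * n)) ⟨-w, hw'⟩ := by
  have hw₀ := hw
  simp only [Nvn, Set.mem_insert_iff, Set.mem_singleton_iff] at hw₀
  rcases hw₀ with rfl | rfl | rfl | rfl
  · subst hq
    exact cell_north_eq_south hn h h'
  · subst hq
    exact cell_east_eq_west hN hτ hn h h'
  · obtain rfl : p = q + (0, 1) := by rw [← hq]; ext <;> simp
    exact (cell_north_eq_south hn h' h).symm
  · obtain rfl : p = q + (1, 0) := by rw [← hq]; ext <;> simp
    exact (cell_east_eq_west hN hτ hn h' h).symm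

end Matching

lemma tdom_macroTile_finite {X : Type} {N : Set Pos} {s : ℤ} (hs : 0 < s) (t : Tile X N) :
    (tdom (macroTile s t)).Finite := by
  refine (((Set.finite_Icc 0 s).prod (Set.finite_Icc 0 s)).image
    (fun q : Pos => (q.1, q.2 + s * shear q.1))).subset ?_
  intro p hp
  have hp' := macroTile_ne_none.1 hp
  simp only [owner, Prod.mk.injEq] at hp'
  refine ⟨(p.1 % s, p.2 % s), ⟨⟨Int.emod_nonneg _ hs.ne', (Int.emod_lt_of_pos _ hs).le⟩,
    ⟨Int.emod_nonneg _ hs.ne', (Int.emod_lt_of_pos _ hs).le⟩⟩, ?_⟩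
  have h1 := Int.emod_add_mul_ediv p.1 s
  have h2 := Int.emod_add_mul_ediv p.2 s
  rw [hp'.1, mul_zero, add_zero] at h1
  ext
  · exact h1
  · change p.2 % s + s * shear (p.1 % s) = p.2
    rwa [← sub_eq_zero.1 hp'.2]

lemma isFiniteTiling_macroTile {X : Type} {N : Set Pos} (hN : IsNeighborhood N) {n : ℤ}
    (hn : 1 ≤ n) (t : Tile X N) : IsFiniteTiling Set.univ (macroTile (2 * n) t) := by
  refine ⟨⟨fun _ _ _ => trivial, ?_⟩, tdom_macroTile_finite (by omega) t⟩
  intro p a ha w b hb hw hw'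
  obtain ⟨hp, rfl⟩ := macroTile_eq_some.1 ha
  obtain ⟨hq, rfl⟩ := macroTile_eq_some.1 hb
  have hτ : IsTiling Set.univ (fun u : Pos => if u = (0, 0) then some t else none) := by
    refine ⟨fun _ _ _ => trivial, ?_⟩
    intro p t₁ h₁ w t₂ h₂ hw _
    have hp : p = (0, 0) := by by_contra h; simp [h] at h₁
    have hpw : p + w = (0, 0) := by by_contra h; simp [h] at h₂
    refine absurd hw ?_
    have : w = (0, 0) := by rwa [hp, show (0, 0) + w = w from zero_add w] at hpw
    rw [this]
    exact hN.2.1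
  exact cell_matches hN hτ hn rfl (by simp [hp]) (by simp [hq]) hw hw'

lemma macroTiling_eq_some {X : Type} {N : Set Pos} {s : ℤ} {τ : Pos → Option (Tile X N)}
    {u : Pos} {σu : Pos → Option (Tile (MacroGlue X N) Nvn)} :
    macroTiling s τ u = some σu ↔ ∃ t, τ u = some t ∧ macroTile s t = σu := by
  simp [macroTiling]

lemma isPolyTiling_macroTiling {X : Type} {N : Set Pos} (hN : IsNeighborhood N)
    {T : Set (Tile X N)} {n : ℤ} (hn : 1 ≤ n) {τ : Pos → Option (Tile X N)}
    (hτ : IsTiling T τ) : IsPolyTiling Set.univ (2 * n) (macroTiling (2 * n) τ) := by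
  have hs : 0 < 2 * n := by omega
  refine ⟨?_, ?_, ?_⟩
  · intro u τu hu
    obtain ⟨t, -, rfl⟩ := macroTiling_eq_some.1 hu
    exact isFiniteTiling_macroTile hN hn t
  · intro u v τu τv huv hu hv p hp q hq hpq
    obtain ⟨t, -, rfl⟩ := macroTiling_eq_some.1 hu
    obtain ⟨t', -, rfl⟩ := macroTiling_eq_some.1 hv
    have := congrArg (owner (2 * n)) hpq
    rw [owner_sc_add hs, owner_sc_add hs, macroTile_ne_none.1 hp,
      macroTile_ne_none.1 hq] at this
    exact huv (add_right_cancel this)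
  · intro u u' τu τu' hu hu' v a ha v' b hb hw hw'
    obtain ⟨t, ht, rfl⟩ := macroTiling_eq_some.1 hu
    obtain ⟨t', ht', rfl⟩ := macroTiling_eq_some.1 hu'
    obtain ⟨hv, rfl⟩ := macroTile_eq_some.1 ha
    obtain ⟨hv', rfl⟩ := macroTile_eq_some.1 hb
    have ho : owner (2 * n) (sc (2 * n) u + v) = u := by
      rw [owner_sc_add hs, hv]; exact add_zero u
    have ho' : owner (2 * n) (sc (2 * n) u' + v') = u' := by
      rw [owner_sc_add hs, hv']; exact add_zero u'
    have := cell_matches hN hτ hn (add_sub_cancel (sc (2 * n) u + v) (sc (2 * n) u' + v'))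
      (by rw [ho, ht]) (by rw [ho', ht']) hw hw'
    simpa only [sc_add_emod_fst, sc_add_emod_snd] using this

lemma readTiling_spec {X : Type} {N : Set Pos} {s : ℤ} {T : Set (Tile X N)}
    {τ' : Pos → Option (Tile (MacroGlue X N) Nvn)} {u : Pos} {t : Tile X N}
    (h : readTiling s T τ' u = some t) : t ∈ T ∧ Occurs s t τ' u := by
  unfold readTiling at h
  split_ifs at h with hex
  rw [← Option.some.inj h]
  exact hex.choose_spec

lemma readTiling_ne_none {X : Type} {N : Set Pos} {s : ℤ} {T : Set (Tile X N)}
    {τ' : Pos → Option (Tile (MacroGlue X N) Nvn)} {u : Pos} {t : Tile X N}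
    (ht : t ∈ T) (h : Occurs s t τ' u) : readTiling s T τ' u ≠ none := by
  unfold readTiling
  rw [dif_pos ⟨t, ht, h⟩]
  simp

lemma Occurs.apply {X : Type} {N : Set Pos} {s : ℤ} {t : Tile X N}
    {τ' : Pos → Option (Tile (MacroGlue X N) Nvn)} {u p : Pos} (h : Occurs s t τ' u)
    (hp : owner s p = (0, 0)) :
    τ' (sc s u + p) = some (cell s t (p.1 % s) (p.2 % s)) :=
  h p _ (macroTile_eq_some.2 ⟨hp, rfl⟩)

/-- Macro tiles at distance `k` in the vertical direction touch, and their common edges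
carry the simulated glues. -/
lemma simGlue_eq_of_occurs {X : Type} {N : Set Pos} {n k : ℤ} (hk : 1 ≤ k) (hkn : k ≤ n)
    {τ' : Pos → Option (Tile (MacroGlue X N) Nvn)} (hτ' : IsTiling Set.univ τ')
    {t t' : Tile X N} {u : Pos} (h : Occurs (2 * n) t τ' u)
    (h' : Occurs (2 * n) t' τ' (u + (0, k))) :
    simGlue t (0, k) = simGlue t' (0, -k) := by
  have e1 : (2 * k - 2) % (2 * n) = 2 * k - 2 := Int.emod_eq_of_lt (by omega) (by omega)
  have e2 : (2 * k - 1) % (2 * n) = 2 * k - 1 := Int.emod_eq_of_lt (by omega) (by omega)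
  have d1 : (2 * k - 2) / (2 * n) = 0 := Int.ediv_eq_zero_of_lt (by omega) (by omega)
  have d2 : (2 * k - 1) / (2 * n) = 0 := Int.ediv_eq_zero_of_lt (by omega) (by omega)
  have ho' : owner (2 * n) (2 * k - 2, 0) = (0, 0) := by
    simp only [owner, e1, d1, shear, Prod.mk.injEq]
    rw [if_neg (by omega)]
    simp
  have ho : owner (2 * n) (2 * k - 1, 2 * n * k) = (0, 0) := by
    simp only [owner, e2, d2, shear, Prod.mk.injEq]
    rw [if_pos (by omega), Int.mul_ediv_cancel_left _ (by omega)]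
    exact ⟨trivial, by omega⟩
  have a' := h'.apply ho'
  have a := h.apply ho
  have hadj : sc (2 * n) u + (2 * k - 1, 2 * n * k) =
      sc (2 * n) (u + (0, k)) + (2 * k - 2, 0) + (1, 0) := by
    ext <;> simp [sc] <;> ring
  rw [hadj] at a
  have hglue := hτ'.2 _ _ a' (1, 0) _ a east_mem west_mem
  erw [cell_east, cell_west] at hglue
  simp only [e1, e2] at hglue
  rw [if_pos (by omega), if_pos (by omega), show (2 * k - 2) / 2 + 1 = k by omega,
    show (2 * k - 1) / 2 + 1 = k by omega] at hglue
  exact hglue.symm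

lemma isTiling_readTiling {X : Type} {N : Set Pos} (hN : IsNeighborhood N)
    (hvert : ∀ w ∈ N, w.1 = 0) {T : Set (Tile X N)} {n : ℤ} (hn : ∀ w ∈ N, |w.2| ≤ n)
    {τ' : Pos → Option (Tile (MacroGlue X N) Nvn)} (hτ' : IsTiling Set.univ τ') :
    IsTiling T (readTiling (2 * n) T τ') := by
  refine ⟨fun p t h => (readTiling_spec h).1, ?_⟩
  rintro p t h ⟨i, k⟩ t' h' hw hw'
  obtain rfl : i = 0 := hvert _ hw
  have hkn := abs_le.1 (hn _ hw)
  have hm : ((0, -k) : Pos) ∈ N := by simpa using hw'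
  have hk0 : k ≠ 0 := by
    rintro rfl
    exact hN.2.1 hw
  have key : simGlue t (0, k) = simGlue t' (0, -k) := by
    rcases lt_or_gt_of_ne hk0 with hk | hk
    · have hp : p + (0, k) + (0, -k) = p := by ext <;> simp
      have := simGlue_eq_of_occurs (k := -k) (n := n) (by omega) (by have := hkn.1; simp at this; omega)
        hτ' (readTiling_spec h').2 (by rw [hp]; exact (readTiling_spec h).2)
      rw [neg_neg] at this
      exact this.symm
    · exact simGlue_eq_of_occurs (by omega) hkn.2 hτ' (readTiling_spec h).2
        (readTiling_spec h').2
  rw [simGlue, simGlue, dif_pos hw, dif_pos hm] at key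
  have := Sum.inr.inj (Option.some.inj key)
  rw [this]
  congr 2

lemma macroTiling_injective {X : Type} {N : Set Pos} {s : ℤ} (hs : 2 ≤ s) :
    Function.Injective (macroTiling (X := X) (N := N) s) := fun _ _ h =>
  funext fun u => Option.map_injective (macroTile_injective hs) (congrFun h u)

/-- The simulation of `T` by sheared macro tiles. -/
noncomputable def shearSimulation {X : Type} {N : Set Pos} (hN : IsNeighborhood N)
    (hvert : ∀ w ∈ N, w.1 = 0) (T : Set (Tile X N)) {n : ℤ} (hn : 1 ≤ n)
    (hbound : ∀ w ∈ N, |w.2| ≤ n) :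
    TilingSimulation X (MacroGlue X N) N T Set.univ (2 * n) where
  hs := by omega
  phi t := {macroTile (2 * n) t}
  phi_fin := by
    rintro t _ rfl
    exact isFiniteTiling_macroTile hN hn t
  phi_ref := by
    rintro t _ rfl
    exact macroTile_zero _ t
  phi_spec := by
    rintro t t' htt' _ rfl _ rfl p q a b ha hb rfl
    exact htt' (eq_of_cell_eq (by omega)
      ((macroTile_eq_some.1 ha).2.trans (macroTile_eq_some.1 hb).2.symm))
  chi τ' := macroTiling (2 * n) (readTiling (2 * n) T τ')
  chi_poly τ' hτ' := isPolyTiling_macroTiling hN hn (isTiling_readTiling hN hvert hbound hτ')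
  chi_sub := by
    intro τ' u σu h
    obtain ⟨t, ht, rfl⟩ := macroTiling_eq_some.1 h
    exact ⟨⟨t, (readTiling_spec ht).1, rfl⟩, (readTiling_spec ht).2⟩
  chi_max := by
    rintro τ' t ht _ rfl u h
    simpa [macroTiling] using readTiling_ne_none ht h
  psi τ := {macroTiling (2 * n) τ}
  psi_nonempty _ _ := Set.singleton_nonempty _
  psi_poly := by
    rintro τ hτ _ rfl
    exact isPolyTiling_macroTiling hN hn hτ
  psi_dom := by
    rintro τ - _ rfl u
    simp [macroTiling]
  psi_comp := by
    rintro τ - _ rfl u t ht σu hσ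
    obtain ⟨t', ht', rfl⟩ := macroTiling_eq_some.1 hσ
    rw [ht] at ht'
    rw [Option.some.inj ht']
    rfl
  psi_recover τ' hτ' := ⟨readTiling (2 * n) T τ',
    ⟨isTiling_readTiling hN hvert hbound hτ', rfl⟩,
    fun _ h => (macroTiling_injective (by omega) h.2).symm⟩

lemma induced_macroTiling_ne_none {X : Type} {N : Set Pos} {s : ℤ} (hs : 0 < s)
    {τ : Pos → Option (Tile X N)} {p : Pos} :
    induced s (macroTiling s τ) p ≠ none ↔ τ (owner s p) ≠ none := by
  constructor
  · intro h
    unfold induced at h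
    split_ifs at h with hex
    · obtain ⟨_, u, _, v, hu, hv, rfl⟩ := hex
      obtain ⟨t, ht, rfl⟩ := macroTiling_eq_some.1 hu
      rw [owner_sc_add hs, (macroTile_eq_some.1 hv).1,
        show u + (0, 0) = u from add_zero u, ht]
      simp
    · exact absurd rfl h
  · intro h
    obtain ⟨t, ht⟩ := Option.ne_none_iff_exists'.1 h
    have hp : p = sc s (owner s p) + (p - sc s (owner s p)) := (add_sub_cancel _ _).symm
    have ho : owner s (p - sc s (owner s p)) = (0, 0) := by
      have := congrArg (owner s) hp
      rw [owner_sc_add hs] at this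
      exact left_eq_add.1 this
    unfold induced
    rw [dif_pos ⟨_, owner s p, _, _, macroTiling_eq_some.2 ⟨t, ht, rfl⟩,
      macroTile_eq_some.2 ⟨ho, rfl⟩, hp⟩]
    simp

lemma columnConvex_induced_macroTiling {X : Type} {N : Set Pos} {s : ℤ} (hs : 0 < s)
    {τ : Pos → Option (Tile X N)} :
    ColumnConvex (induced s (macroTiling s τ)) ↔ ColumnConvex τ := by
  unfold ColumnConvex
  simp only [induced_macroTiling_ne_none hs, owner]
  constructor
  · intro h x y₁ y₂ y h₁ h₂ hy₁ hy₂
    have := h (s * x) (s * y₁) (s * y₂) (s * y)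
    simp only [Int.mul_ediv_cancel_left _ hs.ne', Int.mul_emod_right, shear,
      Int.zero_emod, zero_ne_one, if_false, sub_zero] at this
    exact this h₁ h₂ (mul_lt_mul_of_pos_left hy₁ hs) (mul_lt_mul_of_pos_left hy₂ hs)
  · intro h x y₁ y₂ y h₁ h₂ hy₁ hy₂
    rcases (Int.ediv_le_ediv hs hy₁.le).eq_or_lt with e₁ | l₁
    · rwa [← e₁]
    rcases (Int.ediv_le_ediv hs hy₂.le).eq_or_lt with e₂ | l₂
    · rwa [e₂]
    exact h _ _ _ _ h₁ h₂ (by omega) (by omega)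

/-- for a vertical neighborhood, a tiling-simulation preserving
column convexity. -/
theorem stmt14 (X : Type) [Fintype X] (N : Set Pos) (hN : IsNeighborhood N)
    (hvert : ∀ w ∈ N, w.1 = 0) (T : Set (Tile X N)) (hT : T.Finite) :
    ∃ (Xμ : Type) (_ : Fintype Xμ) (Tμ : Set (Tile Xμ Nvn)) (_ : Tμ.Finite)
      (s : ℤ) (sim : TilingSimulation X Xμ N T Tμ s),
      ∀ τ, IsTiling T τ →
        (ColumnConvex τ ↔ ∀ σ ∈ sim.psi τ, ColumnConvex (induced s σ)) := by
  obtain ⟨m, hm⟩ := (hN.1.image fun w => |w.2|).bddAbove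
  have hbound : ∀ w ∈ N, |w.2| ≤ max m 1 := fun w hw =>
    (hm (Set.mem_image_of_mem _ hw)).trans (le_max_left _ _)
  have hn : 1 ≤ max m 1 := le_max_right _ _
  have : Finite {w : Pos // w ∈ N} := hN.1
  have hvn : Nvn.Finite := by
    unfold Nvn
    exact Set.toFinite _
  have : Finite {w : Pos // w ∈ Nvn} := hvn
  refine ⟨MacroGlue X N, Fintype.ofFinite _, Set.univ, Set.toFinite _, _,
    shearSimulation hN hvert T hn hbound, fun τ _ => ?_⟩
  refine (columnConvex_induced_macroTiling (s := 2 * max m 1) (by omega)).symm.trans ?_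
  exact ⟨fun h σ hσ => hσ ▸ h, fun h => h _ rfl⟩

end Paper
end

section
/- Let N be a linear neighborhood and n ≥ 1 with N ⊆ N_n, let T be a tile system in neighborhood N over glues X, and fix any glue g ∈ X. Define ζ_g : (N → X) → (N_n → X) by ζ_g(t)(i,j) = t(i,j) if (i,j) ∈ N and ζ_g(t)(i,j) = g otherwise, and let T' = ζ_g(T) (a tile system in neighborhood N_n). Then for every D ⊆ ℤ² and τ : D → T, τ is a (T,N)-tiling if and only if the map (x,y) ↦ ζ_g(τ(x,y)) is a (T',N_n)-tiling. -/
namespace Paper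

open scoped Classical

/-- replacing a linear neighborhood by an equivalent connected
linear neighborhood `N_n ⊇ N`, padding the missing glues with a dummy glue `g`. -/
theorem stmt15 (X : Type) [Fintype X] (N : Set Pos) (hN : IsNeighborhood N)
    (hlin : ∀ w ∈ N, w.2 = 0) (n : ℤ) (hn : 1 ≤ n) (hsub : N ⊆ Nlin n)
    (T : Set (Tile X N)) (hT : T.Finite) (g : X)
    (ζ : Tile X N → Tile X (Nlin n))
    (hζ : ∀ (t : Tile X N) (w : {w : Pos // w ∈ Nlin n}) (h : w.1 ∈ N),
      ζ t w = t ⟨w.1, h⟩)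
    (hζ' : ∀ (t : Tile X N) (w : {w : Pos // w ∈ Nlin n}), w.1 ∉ N → ζ t w = g)
    (τ : Pos → Option (Tile X N)) (hτT : ∀ p t, τ p = some t → t ∈ T) :
    IsTiling T τ ↔ IsTiling (ζ '' T) (fun p => (τ p).map ζ) := by
  constructor
  · rintro ⟨-, hmatch⟩
    refine ⟨?_, ?_⟩
    · intro p t' ht'
      obtain ⟨t, ht, rfl⟩ := Option.map_eq_some_iff.mp ht'
      exact ⟨t, hτT p t ht, rfl⟩
    · intro p s hs w s' hs' hw hw'
      obtain ⟨t, ht, rfl⟩ := Option.map_eq_some_iff.mp hs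
      obtain ⟨t', ht', rfl⟩ := Option.map_eq_some_iff.mp hs'
      by_cases h : w ∈ N
      · have h' : -w ∈ N := hN.2.2 w h
        rw [hζ t ⟨w, hw⟩ h, hζ t' ⟨-w, hw'⟩ h']
        exact hmatch p t ht w t' ht' h h'
      · have h' : -w ∉ N := fun h' => h (neg_neg w ▸ hN.2.2 (-w) h')
        rw [hζ' t ⟨w, hw⟩ h, hζ' t' ⟨-w, hw'⟩ h']
  · rintro ⟨-, hmatch⟩
    refine ⟨hτT, fun p t ht w t' ht' hw hw' => ?_⟩
    rw [← hζ t ⟨w, hsub hw⟩ hw, ← hζ t' ⟨-w, hsub hw'⟩ hw']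
    exact hmatch p (ζ t) (Option.map_eq_some_iff.mpr ⟨t, ht, rfl⟩) w (ζ t')
      (Option.map_eq_some_iff.mpr ⟨t', ht', rfl⟩) (hsub hw) (hsub hw')

end Paper
end
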